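/- arXiv:2605.03960 — 2 statements merged into one kernel-verified Lean document; each statement's English description precedes it below -/
import Mathlib

section
/- Let d be a positive integer, (λ_n)_{n≥1} a nondecreasing sequence of positive real numbers with λ_n/n^{2/d} → L as n → ∞ for some L > 0, s_0 < 0 real, and m ≥ 1 an integer. Define G(λ) = Σ_{n≥1} (−1)^{m−1} (m−1)! e^{s_0 λ_n} / (λ + λ_n)^m and b_i = ((−1)^{m+i−1} (m+i−1)!/i!) · Σ_{n≥1} e^{s_0 λ_n} λ_n^i for i ≥ 0 (all series converging absolutely). Then: (1) G converges absolutely and locally uniformly on ℂ ∖ {−λ_n : n ≥ 1} and equals the (m−1)-st derivative of F(λ) = Σ_{n≥1} e^{s_0 λ_n}/(λ + λ_n); (2) for every θ ∈ (−π/2, π/2) and λ with Re(λ e^{iθ}) > 0, G(λ) = ∫_0^{e^{iθ}∞} (−t)^{m−1} Θ(t − s_0) e^{−λt} dt, where Θ(t) = Σ_{n≥1} e^{−λ_n t}; (3) for every closed subinterval J ⊂ (−π/2, π/2) there exist L₀, M > 0 such that for every integer N ≥ m and every λ ∈ ⋃_{θ∈J} {Re(λ e^{iθ}) > 0}, |G(λ)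 − Σ_{i=0}^{N−m} b_i λ^{−m−i}| ≤ L₀ M^N N! |λ|^{−N−1}. -/
open Filter MeasureTheory Set
open scoped Topology Real

/-- The exponentially deformed series `F(λ) = Σ_{n≥1} e^{s₀ λ_n}/(λ + λ_n)`. -/
noncomputable def Fdef (lam : ℕ → ℝ) (s0 : ℝ) (z : ℂ) : ℂ :=
  ∑' n : ℕ, Complex.exp ((s0 : ℂ) * (lam n : ℂ)) / (z + (lam n : ℂ))

/-- `G(λ) = Σ_{n≥1} (-1)^{m-1} (m-1)! e^{s₀ λ_n}/(λ + λ_n)^m`. -/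
noncomputable def Gdef (lam : ℕ → ℝ) (s0 : ℝ) (m : ℕ) (z : ℂ) : ℂ :=
  ∑' n : ℕ, (-1 : ℂ) ^ (m - 1) * (Nat.factorial (m - 1) : ℂ) *
      Complex.exp ((s0 : ℂ) * (lam n : ℂ)) / (z + (lam n : ℂ)) ^ m

/-- `b_i = ((-1)^{m+i-1} (m+i-1)!/i!) Σ_{n≥1} e^{s₀ λ_n} λ_n^i`. -/
noncomputable def bdef (lam : ℕ → ℝ) (s0 : ℝ) (m i : ℕ) : ℂ :=
  (-1 : ℂ) ^ (m + i - 1) * (Nat.factorial (m + i - 1) : ℂ) / (Nat.factorial i : ℂ) *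
    ∑' n : ℕ, Complex.exp ((s0 : ℂ) * (lam n : ℂ)) * (lam n : ℂ) ^ i

lemma aux_weyl (d : ℕ) (hd : 0 < d) (lam : ℕ → ℝ) (L : ℝ) (hL : 0 < L)
    (hweyl : Tendsto (fun n : ℕ => lam n / (((n : ℝ) + 1) ^ ((2 : ℝ) / (d : ℝ))))
      atTop (𝓝 L)) :
    ∀ᶠ n : ℕ in atTop, (L / 2) * ((n : ℝ) + 1) ^ ((2 : ℝ) / (d : ℝ)) ≤ lam n := by
  filter_upwards [hweyl.eventually (lt_mem_nhds (half_lt_self hL))] with n hn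
  have : (0 : ℝ) < ((n : ℝ) + 1) ^ ((2 : ℝ) / (d : ℝ)) := by positivity
  rw [lt_div_iff₀ this] at hn
  exact hn.le

lemma aux_tendsto (d : ℕ) (hd : 0 < d) (lam : ℕ → ℝ) (L : ℝ) (hL : 0 < L)
    (hweyl : Tendsto (fun n : ℕ => lam n / (((n : ℝ) + 1) ^ ((2 : ℝ) / (d : ℝ))))
      atTop (𝓝 L)) : Tendsto lam atTop atTop := by
  refine tendsto_atTop_mono' _ (aux_weyl d hd lam L hL hweyl) ?_
  refine Tendsto.const_mul_atTop (by positivity) ?_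
  have h2 : (0 : ℝ) < (2 : ℝ) / d := by positivity
  exact (tendsto_rpow_atTop h2).comp (tendsto_atTop_add_const_right _ _ tendsto_natCast_atTop_atTop)

lemma aux_summable (d : ℕ) (hd : 0 < d) (lam : ℕ → ℝ) (hpos : ∀ n, 0 < lam n) (L : ℝ) (hL : 0 < L)
    (hweyl : Tendsto (fun n : ℕ => lam n / (((n : ℝ) + 1) ^ ((2 : ℝ) / (d : ℝ))))
      atTop (𝓝 L)) (a : ℝ) (ha : 0 < a) : Summable (fun n => Real.exp (-(a * lam n))) := by
  have hs : Summable (fun n : ℕ => ((d.factorial : ℝ) / (a * (L / 2)) ^ d) * (1 / ((n : ℝ) + 1) ^ 2)) := by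
    apply Summable.mul_left
    have := (summable_nat_add_iff 1).2 (Real.summable_one_div_nat_pow.2 (one_lt_two))
    simpa using this
  refine Summable.of_norm_bounded_eventually_nat hs ?_
  filter_upwards [aux_weyl d hd lam L hL hweyl] with n hn
  rw [Real.norm_of_nonneg (Real.exp_pos _).le, Real.exp_neg]
  have h1 := Real.pow_div_factorial_le_exp _ (mul_pos ha (hpos n)).le d
  have h3 : (((n : ℝ) + 1) ^ ((2 : ℝ) / (d : ℝ))) ^ d = ((n : ℝ) + 1) ^ 2 := by
    rw [← Real.rpow_natCast, ← Real.rpow_mul (by positivity)]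
    rw [div_mul_cancel₀ _ (by positivity)]
    norm_num
  have h2 : (a * (L / 2)) ^ d * ((n : ℝ) + 1) ^ 2 ≤ (a * lam n) ^ d := by
    rw [← h3, ← mul_pow]
    apply pow_le_pow_left₀ (by positivity)
    rw [mul_assoc]
    gcongr
  have h4 : (0 : ℝ) < d.factorial := by positivity
  have h5 : (a * (L / 2)) ^ d * ((n : ℝ) + 1) ^ 2 / d.factorial ≤ Real.exp (a * lam n) :=
    le_trans (by gcongr) h1
  calc (Real.exp (a * lam n))⁻¹ ≤ ((a * (L / 2)) ^ d * ((n : ℝ) + 1) ^ 2 / d.factorial)⁻¹ := by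
        apply inv_anti₀ (by positivity) h5
    _ = _ := by field_simp

lemma aux_norm_exp (s x : ℝ) : ‖Complex.exp ((s : ℂ) * (x : ℂ))‖ = Real.exp (s * x) := by
  rw [Complex.norm_exp]; simp

/-- split the exponential -/
lemma aux_bound (s0 : ℝ) (hs0 : s0 < 0) (x : ℝ) (hx : 0 < x) (i : ℕ) :
    Real.exp (s0 * x) * x ^ i ≤ ((i.factorial : ℝ) / (-s0 / 2) ^ i) * Real.exp (-((-s0 / 2) * x)) := by
  have ha : 0 < -s0 / 2 := by linarith
  have h1 := Real.pow_div_factorial_le_exp _ (mul_pos ha hx).le i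
  have h4 : (0 : ℝ) < i.factorial := by positivity
  rw [div_le_iff₀ h4, mul_pow] at h1
  have e : Real.exp (s0 * x) = Real.exp (-((-s0 / 2) * x)) * Real.exp (-((-s0 / 2) * x)) := by
    rw [← Real.exp_add]; ring_nf
  have e2 : Real.exp (-((-s0 / 2) * x)) * Real.exp ((-s0 / 2) * x) = 1 := by
    rw [← Real.exp_add]; simp
  rw [div_mul_eq_mul_div, le_div_iff₀ (by positivity), e]
  calc _ = Real.exp (-((-s0 / 2) * x)) * Real.exp (-((-s0 / 2) * x)) * ((-s0 / 2) ^ i * x ^ i) := by ring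
    _ ≤ Real.exp (-((-s0 / 2) * x)) * Real.exp (-((-s0 / 2) * x)) * (Real.exp (-s0 / 2 * x) * i.factorial) := by gcongr
    _ = (i.factorial) * Real.exp (-((-s0 / 2) * x)) * (Real.exp (-((-s0 / 2) * x)) * Real.exp ((-s0 / 2) * x)) := by ring
    _ = _ := by rw [e2, mul_one]

lemma aux_sep (lam : ℕ → ℝ) (hT : Tendsto lam atTop atTop) (z0 : ℂ)
    (hz : ∀ n : ℕ, z0 ≠ -(lam n : ℂ)) :
    ∃ δ > 0, ∀ z ∈ Metric.ball z0 δ, ∀ n, δ ≤ ‖z + (lam n : ℂ)‖ := by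
  have hev : ∀ᶠ n in atTop, 1 ≤ ‖z0 + (lam n : ℂ)‖ := by
    filter_upwards [hT.eventually_ge_atTop (1 + ‖z0‖)] with n hn
    have h1 : ‖(lam n : ℂ)‖ ≤ ‖z0 + (lam n : ℂ)‖ + ‖z0‖ := by
      have := norm_sub_le (z0 + (lam n : ℂ)) z0
      simpa using this
    have h2 : lam n ≤ ‖(lam n : ℂ)‖ := by
      rw [Complex.norm_real]; exact le_abs_self _
    linarith
  obtain ⟨K, hK⟩ := eventually_atTop.1 hev
  have hfin : ∀ K : ℕ, ∃ δ > 0, δ ≤ 1 ∧ ∀ n < K, δ ≤ ‖z0 + (lam n : ℂ)‖ := by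
    intro K
    induction K with
    | zero => exact ⟨1, one_pos, le_rfl, by simp⟩
    | succ K ih =>
      obtain ⟨δ, h0, h1, h2⟩ := ih
      refine ⟨min δ ‖z0 + (lam K : ℂ)‖, lt_min h0 ?_, (min_le_left _ _).trans h1, ?_⟩
      · rw [norm_pos_iff]
        intro h
        exact hz K (eq_neg_of_add_eq_zero_left h)
      · intro n hn
        rcases Nat.lt_succ_iff_lt_or_eq.1 hn with h | h
        · exact (min_le_left _ _).trans (h2 n h)
        · subst h; exact min_le_right _ _
  obtain ⟨δ, h0, h1, h2⟩ := hfin K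
  refine ⟨δ / 2, by positivity, fun z hzb n => ?_⟩
  have h3 : δ ≤ ‖z0 + (lam n : ℂ)‖ := by
    rcases lt_or_ge n K with h | h
    · exact h2 n h
    · exact h1.trans (hK n h)
  rw [Metric.mem_ball, dist_comm, dist_eq_norm] at hzb
  have h4 : ‖z0 + (lam n : ℂ)‖ ≤ ‖z0 - z‖ + ‖z + (lam n : ℂ)‖ := by
    have := norm_add_le (z0 - z) (z + (lam n : ℂ))
    rwa [show z0 - z + (z + (lam n : ℂ)) = z0 + (lam n : ℂ) by ring] at this
  linarith

lemma aux_term (lam : ℕ → ℝ) (s0 : ℝ) (m : ℕ) (δ : ℝ) (hδ : 0 < δ) (z : ℂ) (n : ℕ)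
    (h : δ ≤ ‖z + (lam n : ℂ)‖) :
    ‖(-1 : ℂ) ^ (m - 1) * (Nat.factorial (m - 1) : ℂ) *
            Complex.exp ((s0 : ℂ) * (lam n : ℂ)) / (z + (lam n : ℂ)) ^ m‖ ≤
      ((Nat.factorial (m - 1) : ℝ) / δ ^ m) * Real.exp (-((-s0) * lam n)) := by
  rw [norm_div, norm_mul, norm_mul, aux_norm_exp, norm_pow, norm_pow]
  simp only [norm_neg, norm_one, one_pow, one_mul, Complex.norm_natCast, neg_mul, neg_neg]
  rw [div_mul_eq_mul_div]
  gcongr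

lemma aux_deriv (lam : ℕ → ℝ) (hT : Tendsto lam atTop atTop) (s0 : ℝ)
    (hS : Summable (fun n => Real.exp (-((-s0) * lam n)))) (m : ℕ) (hm : 1 ≤ m) (z : ℂ)
    (hz : ∀ n : ℕ, z ≠ -(lam n : ℂ)) :
    HasDerivAt (Gdef lam s0 m) (Gdef lam s0 (m + 1) z) z := by
  obtain ⟨δ, hδ, hb⟩ := aux_sep lam hT z hz
  have hzb : z ∈ Metric.ball z δ := Metric.mem_ball_self hδ
  unfold Gdef
  refine hasDerivAt_tsum_of_isPreconnected (t := Metric.ball z δ) (y₀ := z)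
    (g' := fun n z => (-1 : ℂ) ^ ((m + 1) - 1) * (Nat.factorial ((m + 1) - 1) : ℂ) *
            Complex.exp ((s0 : ℂ) * (lam n : ℂ)) / (z + (lam n : ℂ)) ^ (m + 1))
    (hS.mul_left ((Nat.factorial ((m + 1) - 1) : ℝ) / δ ^ (m + 1))) Metric.isOpen_ball
    (convex_ball z δ).isPreconnected ?_ ?_ hzb ?_ hzb
  · intro n y hy
    have hne : y + (lam n : ℂ) ≠ 0 := by
      intro h
      have := hb y hy n
      rw [h, norm_zero] at this
      linarith
    obtain ⟨k, rfl⟩ : ∃ k, m = k + 1 := ⟨m - 1, by omega⟩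
    have h1 : HasDerivAt (fun y : ℂ => (y + (lam n : ℂ)) ^ (k + 1))
        (((k + 1 : ℕ) : ℂ) * (y + (lam n : ℂ)) ^ k * 1) y := by
      simpa using ((hasDerivAt_id y).add_const (lam n : ℂ)).fun_pow (k + 1)
    have h2 := (hasDerivAt_const y ((-1 : ℂ) ^ ((k + 1) - 1) * (Nat.factorial ((k + 1) - 1) : ℂ) *
            Complex.exp ((s0 : ℂ) * (lam n : ℂ)))).fun_div h1 (pow_ne_zero _ hne)
    refine h2.congr_deriv ?_
    simp only [Nat.add_sub_cancel, Nat.factorial_succ]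
    push_cast
    field_simp
    ring
  · intro n y hy
    exact aux_term lam s0 (m + 1) δ hδ y n (hb y hy n)
  · refine Summable.of_norm_bounded (hS.mul_left ((Nat.factorial (m - 1) : ℝ) / δ ^ m)) ?_
    intro n
    exact aux_term lam s0 m δ hδ z n (hb z hzb n)

lemma aux_iter (lam : ℕ → ℝ) (hT : Tendsto lam atTop atTop) (s0 : ℝ)
    (hS : Summable (fun n => Real.exp (-((-s0) * lam n)))) (k : ℕ) : ∀ (z : ℂ)
    (_ : ∀ n : ℕ, z ≠ -(lam n : ℂ)),
    iteratedDeriv k (Fdef lam s0) z = Gdef lam s0 (k + 1) z := by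
  induction k with
  | zero => intro z hz; simp [Fdef, Gdef]
  | succ k ih =>
    intro z hz
    rw [iteratedDeriv_succ]
    obtain ⟨δ, hδ, hb⟩ := aux_sep lam hT z hz
    have : iteratedDeriv k (Fdef lam s0) =ᶠ[𝓝 z] Gdef lam s0 (k + 1) := by
      filter_upwards [Metric.ball_mem_nhds z hδ] with y hy
      apply ih
      intro n h
      have := hb y hy n
      rw [h, neg_add_cancel, norm_zero] at this
      linarith
    rw [this.deriv_eq]
    exact (aux_deriv lam hT s0 hS (k + 1) (by omega) z hz).deriv

lemma aux_binom (w : ℂ) (c : ℝ) (hc : 0 < c) (hw : c ≤ ‖1 + w‖) (K m : ℕ) (hc1 : c ≤ 1) :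
    ‖((1 + w) ^ (m + 1))⁻¹ - ∑ i ∈ Finset.range (K + 1), ((m + i).choose i : ℂ) * (-w) ^ i‖ ≤
      (c ^ (m + 1))⁻¹ * ((m + 1 + K).choose (K + 1) : ℝ) * ‖w‖ ^ (K + 1) := by
  have hne : (1 + w) ≠ 0 := by
    intro h; rw [h, norm_zero] at hw; linarith
  have hnorm : ‖(1 + w)⁻¹‖ ≤ c⁻¹ := by
    rw [norm_inv]; exact inv_anti₀ hc hw
  induction m with
  | zero =>
    have e : ∀ K : ℕ, ((1 + w) ^ (0 + 1))⁻¹ - ∑ i ∈ Finset.range (K + 1), ((0 + i).choose i : ℂ) * (-w) ^ i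
        = (1 + w)⁻¹ * (-w) ^ (K + 1) := by
      intro K
      induction K with
      | zero => simp; field_simp; ring
      | succ K ih =>
        rw [Finset.sum_range_succ, ← sub_sub, ih]
        simp
        field_simp
        ring
    rw [e, norm_mul, norm_pow, norm_neg]
    rw [zero_add, pow_one, Nat.add_comm 1 K, Nat.choose_self, Nat.cast_one, mul_one]
    gcongr
  | succ m ih =>
    have e : ∀ K : ℕ, (1 + w) * ∑ i ∈ Finset.range (K + 1), ((m + 1 + i).choose i : ℂ) * (-w) ^ i
      = ∑ i ∈ Finset.range (K + 1), ((m + i).choose i : ℂ) * (-w) ^ i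
        - ((m + 1 + K).choose K : ℂ) * (-w) ^ (K + 1) := by
      intro K
      induction K with
      | zero => simp
      | succ K ih =>
        rw [Finset.sum_range_succ, mul_add, ih, Finset.sum_range_succ _ (K + 1)]
        have : (m + 1 + (K + 1)).choose (K + 1) = (m + 1 + K).choose K + (m + (K + 1)).choose (K + 1) := by
          rw [show m + 1 + (K + 1) = (m + 1 + K) + 1 by ring, Nat.choose_succ_succ]
          congr 2; ring
        rw [this]
        push_cast
        ring
    have e2 : ((1 + w) ^ (m + 1 + 1))⁻¹ - ∑ i ∈ Finset.range (K + 1), ((m + 1 + i).choose i : ℂ) * (-w) ^ i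
      = (1 + w)⁻¹ * ((((1 + w) ^ (m + 1))⁻¹ - ∑ i ∈ Finset.range (K + 1), ((m + i).choose i : ℂ) * (-w) ^ i)
        + ((m + 1 + K).choose K : ℂ) * (-w) ^ (K + 1)) := by
      rw [eq_inv_mul_iff_mul_eq₀ hne, mul_sub, e K, pow_succ (1 + w) (m + 1)]
      field_simp
      ring
    rw [e2, norm_mul]
    have hci : 1 ≤ (c ^ (m + 1))⁻¹ := one_le_inv_iff₀.2 ⟨by positivity, pow_le_one₀ hc.le hc1⟩
    have h3 : ‖((m + 1 + K).choose K : ℂ) * (-w) ^ (K + 1)‖ ≤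
        (c ^ (m + 1))⁻¹ * ((m + 1 + K).choose K : ℝ) * ‖w‖ ^ (K + 1) := by
      rw [norm_mul, norm_pow, norm_neg, Complex.norm_natCast, mul_assoc]
      exact le_mul_of_one_le_left (by positivity) hci
    have h4 := (norm_add_le _ _).trans (add_le_add ih h3)
    have h5 : (m + 1 + 1 + K).choose (K + 1) = (m + 1 + K).choose K + (m + 1 + K).choose (K + 1) := by
      rw [show m + 1 + 1 + K = (m + 1 + K) + 1 by ring, Nat.choose_succ_succ]
    calc _ ≤ c⁻¹ * _ := mul_le_mul hnorm h4 (norm_nonneg _) (by positivity)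
      _ = _ := by
        rw [h5, pow_succ c (m + 1), mul_inv]; push_cast; ring

/-- Remainder of one term. -/
lemma aux_rem (z : ℂ) (x : ℝ) (hx : 0 < x) (hz : z ≠ 0) (c : ℝ) (hc : 0 < c) (hc1 : c ≤ 1)
    (h : c * ‖z‖ ≤ ‖z + (x : ℂ)‖) (k K : ℕ) :
    ‖(-1 : ℂ) ^ k * (k.factorial : ℂ) / (z + (x : ℂ)) ^ (k + 1)
      - ∑ i ∈ Finset.range (K + 1), (-1 : ℂ) ^ (k + i) * ((k + i).factorial : ℂ) / (i.factorial : ℂ)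
          * (x : ℂ) ^ i / z ^ (k + 1 + i)‖ ≤
      (c ^ (k + 1))⁻¹ * ((k + 1 + K).factorial : ℝ) / ((K + 1).factorial : ℝ) * x ^ (K + 1)
        / ‖z‖ ^ (k + 1 + K + 1) := by
  have hzn : 0 < ‖z‖ := norm_pos_iff.2 hz
  have hw : c ≤ ‖1 + (x : ℂ) / z‖ := by
    have : 1 + (x : ℂ) / z = (z + x) / z := by field_simp
    rw [this, norm_div, le_div_iff₀ hzn]; exact h
  have key := aux_binom ((x : ℂ) / z) c hc hw K k hc1
  have hne : z + (x : ℂ) ≠ 0 := by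
    intro h0; rw [h0, norm_zero] at h
    have := mul_pos hc hzn
    linarith
  have e : (-1 : ℂ) ^ k * (k.factorial : ℂ) / (z + (x : ℂ)) ^ (k + 1)
      - ∑ i ∈ Finset.range (K + 1), (-1 : ℂ) ^ (k + i) * ((k + i).factorial : ℂ) / (i.factorial : ℂ)
          * (x : ℂ) ^ i / z ^ (k + 1 + i) =
      ((-1 : ℂ) ^ k * (k.factorial : ℂ) / z ^ (k + 1)) * (((1 + (x : ℂ) / z) ^ (k + 1))⁻¹
        - ∑ i ∈ Finset.range (K + 1), ((k + i).choose i : ℂ) * (-((x : ℂ) / z)) ^ i) := by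
    rw [mul_sub, Finset.mul_sum]
    congr 1
    · have : 1 + (x : ℂ) / z = (z + x) / z := by field_simp
      rw [this, div_pow]
      field_simp
    · refine Finset.sum_congr rfl fun i _ => ?_
      have h1 : (((k + i).factorial : ℕ) : ℂ) = ((k + i).choose i : ℂ) * (k.factorial : ℂ) * (i.factorial : ℂ) := by
        have := Nat.add_choose_mul_factorial_mul_factorial k i
        exact_mod_cast this.symm
      have hi : (i.factorial : ℂ) ≠ 0 := by exact_mod_cast i.factorial_ne_zero
      rw [h1, neg_pow ((x : ℂ) / z), div_pow, pow_add (-1 : ℂ), pow_add z (k + 1)]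
      field_simp
  rw [e, norm_mul]
  have h2 : ‖(-1 : ℂ) ^ k * (k.factorial : ℂ) / z ^ (k + 1)‖ = (k.factorial : ℝ) / ‖z‖ ^ (k + 1) := by
    rw [norm_div, norm_mul, norm_pow, norm_pow]; simp
  rw [h2]
  refine (mul_le_mul_of_nonneg_left key (by positivity)).trans (le_of_eq ?_)
  have h1 : (((k + 1 + K).factorial : ℕ) : ℝ) = ((k + 1 + K).choose (K + 1) : ℝ) * (k.factorial : ℝ) * ((K + 1).factorial : ℝ) := by
    have := Nat.add_choose_mul_factorial_mul_factorial k (K + 1)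
    rw [show k + 1 + K = k + (K + 1) by ring]
    exact_mod_cast this.symm
  rw [h1, norm_div, Complex.norm_real, Real.norm_of_nonneg hx.le, div_pow, add_assoc (k + 1) K 1, pow_add ‖z‖ (k + 1)]
  have : ((K + 1).factorial : ℝ) ≠ 0 := by positivity
  field_simp

lemma aux_cos (A B : ℝ) (hA : -(π / 2) < A) (hAB : A ≤ B) (hB : B < π / 2) :
    ∃ c : ℝ, 0 < c ∧ c ≤ 1 ∧ ∀ z : ℂ, (∃ θ ∈ Set.Icc A B, 0 < (z * Complex.exp ((θ : ℂ) * Complex.I)).re) →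
      ∀ x : ℝ, 0 < x → c * ‖z‖ ≤ ‖z + (x : ℂ)‖ := by
  obtain ⟨t, ht, hmin⟩ := isCompact_Icc.exists_isMinOn (nonempty_Icc.2 hAB) (Real.continuous_cos.continuousOn (s := Icc A B))
  have h0 : 0 < Real.cos t := Real.cos_pos_of_mem_Ioo ⟨hA.trans_le ht.1, ht.2.trans_lt hB⟩
  refine ⟨Real.cos t / (1 + Real.cos t), by positivity, ?_, ?_⟩
  · rw [div_le_one (by positivity)]; linarith
  · rintro z ⟨θ, hθ, hre⟩ x hx
    have h1 : Real.cos t ≤ Real.cos θ := hmin hθ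
    have h2 : ((z + x) * Complex.exp ((θ : ℂ) * Complex.I)).re =
        (z * Complex.exp ((θ : ℂ) * Complex.I)).re + x * Real.cos θ := by
      rw [add_mul, Complex.add_re, Complex.re_ofReal_mul, Complex.exp_ofReal_mul_I_re]
    have h3 : ((z + x) * Complex.exp ((θ : ℂ) * Complex.I)).re ≤ ‖z + x‖ := by
      refine (Complex.re_le_norm _).trans (le_of_eq ?_)
      rw [norm_mul, Complex.norm_exp_ofReal_mul_I, mul_one]
    have h4 : x * Real.cos t ≤ ‖z + x‖ := by
      have := mul_le_mul_of_nonneg_left h1 hx.le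
      linarith
    have h5 : ‖z‖ ≤ ‖z + x‖ + x := by
      have := norm_sub_le (z + (x : ℂ)) x
      simpa [abs_of_pos hx] using this
    rw [div_mul_eq_mul_div, div_le_iff₀ (by positivity)]
    nlinarith

lemma aux_gevrey (lam : ℕ → ℝ) (hpos : ∀ n, 0 < lam n) (s0 : ℝ) (hs0 : s0 < 0)
    (hS : ∀ a : ℝ, 0 < a → Summable (fun n => Real.exp (-(a * lam n))))
    (hS1 : ∀ i : ℕ, Summable fun n : ℕ =>
      ‖Complex.exp ((s0 : ℂ) * (lam n : ℂ)) * (lam n : ℂ) ^ i‖)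
    (m : ℕ) (hm : 1 ≤ m)
    (hS2 : ∀ z : ℂ, (∀ n : ℕ, z ≠ -(lam n : ℂ)) →
      Summable fun n : ℕ =>
        ‖(-1 : ℂ) ^ (m - 1) * (Nat.factorial (m - 1) : ℂ) *
            Complex.exp ((s0 : ℂ) * (lam n : ℂ)) / (z + (lam n : ℂ)) ^ m‖)
    (A B : ℝ) (hA : -(π / 2) < A) (hAB : A ≤ B) (hB : B < π / 2) :
      ∃ L₀ M : ℝ, 0 < L₀ ∧ 0 < M ∧
        ∀ N : ℕ, m ≤ N → ∀ z : ℂ,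
          (∃ θ ∈ Set.Icc A B, 0 < (z * Complex.exp ((θ : ℂ) * Complex.I)).re) →
          ‖Gdef lam s0 m z -
              ∑ i ∈ Finset.range (N - m + 1), bdef lam s0 m i / z ^ (m + i)‖
            ≤ L₀ * M ^ N * (Nat.factorial N : ℝ) / ‖z‖ ^ (N + 1) := by
  obtain ⟨c, hc, hc1, hcz⟩ := aux_cos A B hA hAB hB
  have ha : 0 < -s0 / 2 := by linarith
  set T := ∑' n, Real.exp (-((-s0 / 2) * lam n)) with hT
  have hTpos : 0 < T := (hS _ ha).tsum_pos (fun n => (Real.exp_pos _).le) 0 (Real.exp_pos _)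
  refine ⟨(c ^ m)⁻¹ * T, max 1 (-s0 / 2)⁻¹, by positivity, by positivity, ?_⟩
  intro N hN z hz
  have hz0 : z ≠ 0 := by
    rintro rfl
    obtain ⟨θ, -, h⟩ := hz
    simp at h
  have hzn : 0 < ‖z‖ := norm_pos_iff.2 hz0
  obtain ⟨k, rfl⟩ : ∃ k, m = k + 1 := ⟨m - 1, by omega⟩
  obtain ⟨K, rfl⟩ : ∃ K, N = k + 1 + K := ⟨N - (k + 1), by omega⟩
  have hzl : ∀ n : ℕ, z ≠ -(lam n : ℂ) := by
    intro n h
    have h1 := hcz z hz (lam n) (hpos n)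
    have h2 : z + (lam n : ℂ) = 0 := by rw [h]; ring
    rw [h2, norm_zero] at h1
    have := mul_pos hc hzn
    linarith
  have e : Gdef lam s0 (k + 1) z -
      ∑ i ∈ Finset.range (k + 1 + K - (k + 1) + 1), bdef lam s0 (k + 1) i / z ^ (k + 1 + i) =
      ∑' n, Complex.exp ((s0 : ℂ) * (lam n : ℂ)) *
       ((-1 : ℂ) ^ k * (k.factorial : ℂ) / (z + (lam n : ℂ)) ^ (k + 1)
      - ∑ i ∈ Finset.range (K + 1), (-1 : ℂ) ^ (k + i) * ((k + i).factorial : ℂ) / (i.factorial : ℂ)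
          * (lam n : ℂ) ^ i / z ^ (k + 1 + i)) := by
    rw [Nat.add_sub_cancel_left]
    have h1 : ∀ i, bdef lam s0 (k + 1) i / z ^ (k + 1 + i) = ∑' n,
        ((-1 : ℂ) ^ (k + i) * ((k + i).factorial : ℂ) / (i.factorial : ℂ) / z ^ (k + 1 + i)) *
        (Complex.exp ((s0 : ℂ) * (lam n : ℂ)) * (lam n : ℂ) ^ i) := by
      intro i
      rw [tsum_mul_left, bdef, show k + 1 + i - 1 = k + i by omega]
      ring
    simp_rw [h1]
    have hsm : ∀ i ∈ Finset.range (K + 1), Summable (fun n =>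
        ((-1 : ℂ) ^ (k + i) * ((k + i).factorial : ℂ) / (i.factorial : ℂ) / z ^ (k + 1 + i)) *
        (Complex.exp ((s0 : ℂ) * (lam n : ℂ)) * (lam n : ℂ) ^ i)) := fun i _ =>
      (hS1 i).of_norm.mul_left _
    rw [← Summable.tsum_finsetSum hsm, Gdef, ← Summable.tsum_sub (hS2 z hzl).of_norm (summable_sum hsm)]
    refine tsum_congr fun n => ?_
    rw [mul_sub, Finset.mul_sum, Nat.add_sub_cancel]
    congr 1
    · ring
    · refine Finset.sum_congr rfl fun i _ => ?_
      ring
  rw [e]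
  set D := (c ^ (k + 1))⁻¹ * ((k + 1 + K).factorial : ℝ) * ((-s0 / 2)⁻¹) ^ (K + 1) / ‖z‖ ^ (k + 1 + K + 1) with hD
  have hterm : ∀ n, ‖Complex.exp ((s0 : ℂ) * (lam n : ℂ)) *
       ((-1 : ℂ) ^ k * (k.factorial : ℂ) / (z + (lam n : ℂ)) ^ (k + 1)
      - ∑ i ∈ Finset.range (K + 1), (-1 : ℂ) ^ (k + i) * ((k + i).factorial : ℂ) / (i.factorial : ℂ)
          * (lam n : ℂ) ^ i / z ^ (k + 1 + i))‖ ≤ D * Real.exp (-((-s0 / 2) * lam n)) := by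
    intro n
    rw [norm_mul, aux_norm_exp]
    have h1 := aux_rem z (lam n) (hpos n) hz0 c hc hc1 (hcz z hz _ (hpos n)) k K
    have h2 := aux_bound s0 hs0 (lam n) (hpos n) (K + 1)
    calc _ ≤ Real.exp (s0 * lam n) * _ := mul_le_mul_of_nonneg_left h1 (Real.exp_pos _).le
      _ = (c ^ (k + 1))⁻¹ * ((k + 1 + K).factorial : ℝ) / ((K + 1).factorial : ℝ)
        / ‖z‖ ^ (k + 1 + K + 1) * (Real.exp (s0 * lam n) * lam n ^ (K + 1)) := by ring
      _ ≤ (c ^ (k + 1))⁻¹ * ((k + 1 + K).factorial : ℝ) / ((K + 1).factorial : ℝ)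
        / ‖z‖ ^ (k + 1 + K + 1) * _ := mul_le_mul_of_nonneg_left h2 (by positivity)
      _ = _ := by
        rw [hD, inv_pow]
        have : ((K + 1).factorial : ℝ) ≠ 0 := by positivity
        field_simp
  refine (tsum_of_norm_bounded ((hS _ ha).mul_left D).hasSum hterm).trans ?_
  rw [tsum_mul_left, ← hT, hD]
  have hM : ((-s0 / 2)⁻¹) ^ (K + 1) ≤ (max 1 (-s0 / 2)⁻¹) ^ (k + 1 + K) :=
    (pow_le_pow_left₀ (by positivity) (le_max_right 1 _) _).trans
      (pow_le_pow_right₀ (le_max_left _ _) (by omega))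
  calc _ = (c ^ (k + 1))⁻¹ * T * ((-s0 / 2)⁻¹) ^ (K + 1) * ((k + 1 + K).factorial : ℝ) / ‖z‖ ^ (k + 1 + K + 1) := by ring
    _ ≤ _ := by gcongr

lemma aux_pow_norm (w : ℂ) (k : ℕ) (r : ℝ) (hr : 0 < r) :
    ‖(r : ℂ) ^ k * Complex.exp (-w * r)‖ = r ^ (k : ℝ) * Real.exp (-w.re * r) := by
  rw [norm_mul, norm_pow, Complex.norm_real, Real.norm_of_nonneg hr.le, Complex.norm_exp,
    Real.rpow_natCast]
  simp

lemma aux_pow_integrable (w : ℂ) (hw : 0 < w.re) (k : ℕ) :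
    IntegrableOn (fun r : ℝ => (r : ℂ) ^ k * Complex.exp (-w * r)) (Set.Ioi 0) := by
  have hI : IntegrableOn (fun r : ℝ => r ^ (k : ℝ) * Real.exp (-w.re * r ^ (1 : ℝ))) (Set.Ioi 0) :=
    integrableOn_rpow_mul_exp_neg_mul_rpow (by have : (0:ℝ) ≤ k := by positivity
                                               linarith) one_pos hw
  refine Integrable.mono' hI (Continuous.aestronglyMeasurable (by fun_prop)) ?_
  refine (ae_restrict_iff' measurableSet_Ioi).2 (ae_of_all _ fun r hr => ?_)
  rw [aux_pow_norm w k r hr, Real.rpow_one]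

lemma aux_pow_integral (w : ℂ) (hw : 0 < w.re) (k : ℕ) :
    ∫ r in Set.Ioi (0 : ℝ), (r : ℂ) ^ k * Complex.exp (-w * r) = (k.factorial : ℂ) / w ^ (k + 1) := by
  have hw0 : w ≠ 0 := by rintro rfl; simp at hw
  induction k with
  | zero =>
    have := integral_exp_mul_complex_Ioi (a := -w) (by simpa using hw) 0
    simp only [pow_zero, one_mul]
    rw [this]
    simp
  | succ k ih =>
    have hd : ∀ r ∈ Set.Ioi (0 : ℝ), HasDerivAt (fun r : ℝ => (r : ℂ) ^ (k + 1) * Complex.exp (-w * r))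
        (((k + 1 : ℕ) : ℂ) * ((r : ℂ) ^ k * Complex.exp (-w * r))
          - w * ((r : ℂ) ^ (k + 1) * Complex.exp (-w * r))) r := by
      intro r _
      have h1 : HasDerivAt (fun y : ℂ => y ^ (k + 1) * Complex.exp (-w * y))
        (((k + 1 : ℕ) : ℂ) * ((r : ℂ) ^ k * Complex.exp (-w * r))
          - w * ((r : ℂ) ^ (k + 1) * Complex.exp (-w * r))) (r : ℂ) := by
        have h2 := (hasDerivAt_pow (k + 1) (r : ℂ)).fun_mul
          (((hasDerivAt_id (r : ℂ)).const_mul (-w)).cexp)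
        refine h2.congr_deriv ?_
        simp only [Nat.add_sub_cancel, id]
        ring
      exact h1.comp_ofReal
    have hi1 := (aux_pow_integrable w hw k).const_mul ((k + 1 : ℕ) : ℂ)
    have hi2 := (aux_pow_integrable w hw (k + 1)).const_mul w
    have ht : Tendsto (fun r : ℝ => (r : ℂ) ^ (k + 1) * Complex.exp (-w * r)) atTop (𝓝 0) := by
      rw [tendsto_zero_iff_norm_tendsto_zero]
      refine (tendsto_rpow_mul_exp_neg_mul_atTop_nhds_zero ((k + 1 : ℕ) : ℝ) w.re hw).congr' ?_
      filter_upwards [eventually_gt_atTop 0] with r hr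
      rw [aux_pow_norm w (k + 1) r hr]
    have key := integral_Ioi_of_hasDerivAt_of_tendsto
      (Continuous.continuousWithinAt (by fun_prop)) hd (hi1.sub hi2) ht
    rw [integral_sub hi1 hi2, integral_const_mul, integral_const_mul, ih] at key
    simp only [Complex.ofReal_zero, ne_eq, Nat.succ_ne_zero, not_false_eq_true, zero_pow, zero_mul,
      sub_zero] at key
    rw [sub_eq_zero] at key
    have key2 := (eq_div_iff hw0).2 ((mul_comm _ w).trans key.symm)
    rw [key2, Nat.factorial_succ]
    push_cast
    field_simp
    ring

lemma aux_int_one (e w : ℂ) (h : 0 < (w * e).re) (k : ℕ) :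
    ∫ r in Set.Ioi (0 : ℝ), (-((r : ℂ) * e)) ^ k * Complex.exp (-w * (r * e)) * e
      = (-1 : ℂ) ^ k * (k.factorial : ℂ) / w ^ (k + 1) := by
  have hne : w * e ≠ 0 := by intro h0; rw [h0] at h; simp at h
  have hw : w ≠ 0 := left_ne_zero_of_mul hne
  have he : e ≠ 0 := right_ne_zero_of_mul hne
  have key := aux_pow_integral (w * e) h k
  have e1 : ∀ r : ℝ, (-((r : ℂ) * e)) ^ k * Complex.exp (-w * (r * e)) * e =
     ((-1) ^ k * e ^ (k + 1)) * ((r : ℂ) ^ k * Complex.exp (-(w * e) * r)) := by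
    intro r
    rw [neg_pow, mul_pow, show -w * (r * e) = -(w * e) * r by ring]
    ring
  simp_rw [e1]
  rw [integral_const_mul, key, mul_pow]
  field_simp

lemma aux_laplace (lam : ℕ → ℝ) (hpos : ∀ n, 0 < lam n) (s0 : ℝ)
    (hS : Summable (fun n => Real.exp (-((-s0) * lam n)))) (m : ℕ) (hm : 1 ≤ m)
    (θ : ℝ) (hθ : θ ∈ Set.Ioo (-(π / 2)) (π / 2)) (z : ℂ)
    (hz : 0 < (z * Complex.exp ((θ : ℂ) * Complex.I)).re) :
      IntegrableOn
        (fun r : ℝ =>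
          (-((r : ℂ) * Complex.exp ((θ : ℂ) * Complex.I))) ^ (m - 1) *
            (∑' n : ℕ, Complex.exp (-(lam n : ℂ) *
              ((r : ℂ) * Complex.exp ((θ : ℂ) * Complex.I) - (s0 : ℂ)))) *
            Complex.exp (-z * ((r : ℂ) * Complex.exp ((θ : ℂ) * Complex.I))) *
            Complex.exp ((θ : ℂ) * Complex.I))
        (Set.Ioi 0) ∧
      Gdef lam s0 m z
        = ∫ r in Set.Ioi (0 : ℝ),
            (-((r : ℂ) * Complex.exp ((θ : ℂ) * Complex.I))) ^ (m - 1) *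
              (∑' n : ℕ, Complex.exp (-(lam n : ℂ) *
                ((r : ℂ) * Complex.exp ((θ : ℂ) * Complex.I) - (s0 : ℂ)))) *
              Complex.exp (-z * ((r : ℂ) * Complex.exp ((θ : ℂ) * Complex.I))) *
              Complex.exp ((θ : ℂ) * Complex.I) := by
  obtain ⟨k, rfl⟩ : ∃ k, m = k + 1 := ⟨m - 1, by omega⟩
  rw [Nat.add_sub_cancel]
  have hcos : 0 < Real.cos θ := Real.cos_pos_of_mem_Ioo hθ
  have here : (Complex.exp ((θ : ℂ) * Complex.I)).re = Real.cos θ := Complex.exp_ofReal_mul_I_re θ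
  have henorm : ‖Complex.exp ((θ : ℂ) * Complex.I)‖ = 1 := Complex.norm_exp_ofReal_mul_I θ
  set e := Complex.exp ((θ : ℂ) * Complex.I) with he
  set ρ := (z * e).re with hρ
  -- bound on the theta terms
  have hexp : ∀ n (r : ℝ), r ∈ Set.Ici (0 : ℝ) → ‖Complex.exp (-(lam n : ℂ) * ((r : ℂ) * e - (s0 : ℂ)))‖
      ≤ Real.exp (-((-s0) * lam n)) := by
    intro n r hr
    rw [Complex.norm_exp]
    apply Real.exp_le_exp.2
    have : (-(lam n : ℂ) * ((r : ℂ) * e - (s0 : ℂ))).re = - lam n * (r * Real.cos θ - s0) := by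
      rw [← Complex.ofReal_neg, Complex.re_ofReal_mul, Complex.sub_re, Complex.re_ofReal_mul, here, Complex.ofReal_re]
    rw [this]
    have := mul_nonneg (hpos n).le (mul_nonneg (show (0:ℝ) ≤ r from hr) hcos.le)
    nlinarith
  have hbd : ∀ r : ℝ, r ∈ Set.Ioi (0 : ℝ) → ∀ x : ℂ, ‖(-((r : ℂ) * e)) ^ k * x * Complex.exp (-z * ((r : ℂ) * e)) * e‖
      = ‖x‖ * (r ^ (k : ℝ) * Real.exp (-ρ * r ^ (1 : ℝ))) := by
    intro r hr x
    have hr' : (0 : ℝ) < r := hr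
    rw [norm_mul, norm_mul, norm_mul, henorm, norm_pow, norm_neg, norm_mul, henorm, Complex.norm_exp,
      Complex.norm_real, Real.norm_of_nonneg hr'.le, Real.rpow_natCast, Real.rpow_one]
    have : (-z * (r * e)).re = -ρ * r := by
      rw [show -z * (r * e) = (((-r : ℝ)) : ℂ) * (z * e) by push_cast; ring, Complex.re_ofReal_mul]
      ring
    rw [this]; ring
  have hI : IntegrableOn (fun r : ℝ => r ^ (k : ℝ) * Real.exp (-ρ * r ^ (1 : ℝ))) (Set.Ioi 0) :=
    integrableOn_rpow_mul_exp_neg_mul_rpow (by have : (0:ℝ) ≤ k := by positivity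
                                               linarith) one_pos hz
  have hcont : ContinuousOn (fun r : ℝ => ∑' n : ℕ, Complex.exp (-(lam n : ℂ) * ((r : ℂ) * e - (s0 : ℂ)))) (Set.Ioi 0) := by
    refine continuousOn_tsum (fun n => ?_) hS (fun n r hr => hexp n r (le_of_lt (show (0 : ℝ) < r from hr)))
    fun_prop
  have hsum : ∀ r : ℝ, r ∈ Set.Ioi (0 : ℝ) → Summable (fun n => Complex.exp (-(lam n : ℂ) * ((r : ℂ) * e - (s0 : ℂ)))) :=
    fun r hr => Summable.of_norm_bounded hS (fun n => hexp n r (le_of_lt (show (0 : ℝ) < r from hr)))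
  constructor
  · refine Integrable.mono' (hI.const_mul (∑' n, Real.exp (-((-s0) * lam n)))) ?_ ?_
    · refine ContinuousOn.aestronglyMeasurable ?_ measurableSet_Ioi
      fun_prop
    · refine (ae_restrict_iff' measurableSet_Ioi).2 (ae_of_all _ fun r hr => ?_)
      rw [hbd r hr]
      have hr' : (0 : ℝ) < r := hr
      refine mul_le_mul_of_nonneg_right ?_ (by positivity)
      exact tsum_of_norm_bounded hS.hasSum (fun n => hexp n r (le_of_lt (show (0 : ℝ) < r from hr)))
  · have H := hasSum_integral_of_dominated_convergence (μ := volume.restrict (Set.Ioi (0 : ℝ)))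
      (F := fun n (r : ℝ) => (-((r : ℂ) * e)) ^ k * Complex.exp (-(lam n : ℂ) * ((r : ℂ) * e - (s0 : ℂ))) *
          Complex.exp (-z * ((r : ℂ) * e)) * e)
      (f := fun r : ℝ => (-((r : ℂ) * e)) ^ k * (∑' n : ℕ, Complex.exp (-(lam n : ℂ) * ((r : ℂ) * e - (s0 : ℂ)))) *
          Complex.exp (-z * ((r : ℂ) * e)) * e)
      (fun n r => Real.exp (-((-s0) * lam n)) * (r ^ (k : ℝ) * Real.exp (-ρ * r ^ (1 : ℝ))))
      (fun n => Continuous.aestronglyMeasurable (by fun_prop))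
      (fun n => (ae_restrict_iff' measurableSet_Ioi).2 (ae_of_all _ fun r hr => by
        have hr' : (0 : ℝ) < r := hr
        rw [hbd r hr]
        exact mul_le_mul_of_nonneg_right (hexp n r hr'.le) (by positivity)))
      (ae_of_all _ fun r => hS.mul_right _)
      (by simp_rw [tsum_mul_right]; exact hI.const_mul _)
      ((ae_restrict_iff' measurableSet_Ioi).2 (ae_of_all _ fun r hr =>
        (((hsum r hr).hasSum.mul_left _).mul_right _).mul_right _))
    rw [← H.tsum_eq, Gdef]
    refine tsum_congr fun n => ?_
    have hre : 0 < ((z + lam n) * e).re := by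
      rw [add_mul, Complex.add_re, Complex.re_ofReal_mul, here]
      have := mul_pos (hpos n) hcos
      linarith
    have h1 := aux_int_one e (z + lam n) hre k
    have h2 : ∀ r : ℝ, (-((r : ℂ) * e)) ^ k * Complex.exp (-(lam n : ℂ) * ((r : ℂ) * e - (s0 : ℂ))) *
          Complex.exp (-z * ((r : ℂ) * e)) * e = Complex.exp (s0 * lam n) *
          ((-((r : ℂ) * e)) ^ k * Complex.exp (-(z + lam n) * (r * e)) * e) := by
      intro r
      have : Complex.exp (-(lam n : ℂ) * ((r : ℂ) * e - (s0 : ℂ))) * Complex.exp (-z * ((r : ℂ) * e)) =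
         Complex.exp (s0 * lam n) * Complex.exp (-(z + lam n) * (r * e)) := by
        rw [← Complex.exp_add, ← Complex.exp_add]; ring_nf
      linear_combination ((-((r : ℂ) * e)) ^ k * e) * this
    simp_rw [h2]
    rw [integral_const_mul, h1, Nat.add_sub_cancel]
    ring

/-- (1) `G` converges absolutely and locally uniformly on
`ℂ ∖ {-λ_n}` and equals the `(m-1)`-st derivative of `F`; (2) `G(λ)` is the Laplace
transform along any direction `θ ∈ (-π/2, π/2)` of `(-t)^{m-1} Θ(t - s₀)` at `λ` with
`Re(λ e^{iθ}) > 0`; (3) `G` admits `Σ_i b_i λ^{-m-i}` as uniform 1-Gevrey asymptotic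
expansion on sub-sector domains. -/
theorem stmt_11 (d : ℕ) (hd : 0 < d) (lam : ℕ → ℝ) (hpos : ∀ n, 0 < lam n)
    (hmono : Monotone lam) (L : ℝ) (hL : 0 < L)
    (hweyl : Tendsto (fun n : ℕ => lam n / (((n : ℝ) + 1) ^ ((2 : ℝ) / (d : ℝ))))
      atTop (𝓝 L))
    (s0 : ℝ) (hs0 : s0 < 0) (m : ℕ) (hm : 1 ≤ m) :
    (∀ i : ℕ, Summable fun n : ℕ =>
      ‖Complex.exp ((s0 : ℂ) * (lam n : ℂ)) * (lam n : ℂ) ^ i‖) ∧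
    (∀ z : ℂ, (∀ n : ℕ, z ≠ -(lam n : ℂ)) →
      Summable fun n : ℕ =>
        ‖(-1 : ℂ) ^ (m - 1) * (Nat.factorial (m - 1) : ℂ) *
            Complex.exp ((s0 : ℂ) * (lam n : ℂ)) / (z + (lam n : ℂ)) ^ m‖) ∧
    TendstoLocallyUniformlyOn
      (fun (N : ℕ) (z : ℂ) =>
        ∑ n ∈ Finset.range N, (-1 : ℂ) ^ (m - 1) * (Nat.factorial (m - 1) : ℂ) *
          Complex.exp ((s0 : ℂ) * (lam n : ℂ)) / (z + (lam n : ℂ)) ^ m)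
      (Gdef lam s0 m) atTop {z : ℂ | ∀ n : ℕ, z ≠ -(lam n : ℂ)} ∧
    (∀ z : ℂ, (∀ n : ℕ, z ≠ -(lam n : ℂ)) →
      iteratedDeriv (m - 1) (Fdef lam s0) z = Gdef lam s0 m z) ∧
    (∀ θ : ℝ, θ ∈ Set.Ioo (-(π / 2)) (π / 2) → ∀ z : ℂ,
      0 < (z * Complex.exp ((θ : ℂ) * Complex.I)).re →
      IntegrableOn
        (fun r : ℝ =>
          (-((r : ℂ) * Complex.exp ((θ : ℂ) * Complex.I))) ^ (m - 1) *
            (∑' n : ℕ, Complex.exp (-(lam n : ℂ) *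
              ((r : ℂ) * Complex.exp ((θ : ℂ) * Complex.I) - (s0 : ℂ)))) *
            Complex.exp (-z * ((r : ℂ) * Complex.exp ((θ : ℂ) * Complex.I))) *
            Complex.exp ((θ : ℂ) * Complex.I))
        (Set.Ioi 0) ∧
      Gdef lam s0 m z
        = ∫ r in Set.Ioi (0 : ℝ),
            (-((r : ℂ) * Complex.exp ((θ : ℂ) * Complex.I))) ^ (m - 1) *
              (∑' n : ℕ, Complex.exp (-(lam n : ℂ) *
                ((r : ℂ) * Complex.exp ((θ : ℂ) * Complex.I) - (s0 : ℂ)))) *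
              Complex.exp (-z * ((r : ℂ) * Complex.exp ((θ : ℂ) * Complex.I))) *
              Complex.exp ((θ : ℂ) * Complex.I)) ∧
    (∀ A B : ℝ, -(π / 2) < A → A ≤ B → B < π / 2 →
      ∃ L₀ M : ℝ, 0 < L₀ ∧ 0 < M ∧
        ∀ N : ℕ, m ≤ N → ∀ z : ℂ,
          (∃ θ ∈ Set.Icc A B, 0 < (z * Complex.exp ((θ : ℂ) * Complex.I)).re) →
          ‖Gdef lam s0 m z -
              ∑ i ∈ Finset.range (N - m + 1), bdef lam s0 m i / z ^ (m + i)‖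
            ≤ L₀ * M ^ N * (Nat.factorial N : ℝ) / ‖z‖ ^ (N + 1)) := by
  have hT := aux_tendsto d hd lam L hL hweyl
  have hS : ∀ a : ℝ, 0 < a → Summable (fun n => Real.exp (-(a * lam n))) :=
    fun a ha => aux_summable d hd lam hpos L hL hweyl a ha
  have hS0 := hS (-s0) (by linarith)
  have hS1 : ∀ i : ℕ, Summable fun n : ℕ =>
      ‖Complex.exp ((s0 : ℂ) * (lam n : ℂ)) * (lam n : ℂ) ^ i‖ := by
    intro i
    refine Summable.of_nonneg_of_le (fun n => norm_nonneg _) (fun n => ?_)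
      ((hS (-s0 / 2) (by linarith)).mul_left ((i.factorial : ℝ) / (-s0 / 2) ^ i))
    rw [norm_mul, aux_norm_exp, norm_pow, Complex.norm_real, Real.norm_of_nonneg (hpos n).le]
    exact aux_bound s0 hs0 (lam n) (hpos n) i
  have hS2 : ∀ z : ℂ, (∀ n : ℕ, z ≠ -(lam n : ℂ)) →
      Summable fun n : ℕ =>
        ‖(-1 : ℂ) ^ (m - 1) * (Nat.factorial (m - 1) : ℂ) *
            Complex.exp ((s0 : ℂ) * (lam n : ℂ)) / (z + (lam n : ℂ)) ^ m‖ := by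
    intro z hz
    obtain ⟨δ, hδ, hb⟩ := aux_sep lam hT z hz
    exact Summable.of_nonneg_of_le (fun n => norm_nonneg _)
      (fun n => aux_term lam s0 m δ hδ z n (hb z (Metric.mem_ball_self hδ) n)) (hS0.mul_left _)
  refine ⟨hS1, hS2, ?_, ?_, ?_, ?_⟩
  · apply tendstoLocallyUniformlyOn_of_forall_exists_nhds
    intro z hz
    obtain ⟨δ, hδ, hb⟩ := aux_sep lam hT z hz
    refine ⟨Metric.ball z δ, mem_nhdsWithin_of_mem_nhds (Metric.ball_mem_nhds z hδ), ?_⟩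
    exact tendstoUniformlyOn_tsum_nat (hS0.mul_left _)
      (fun n y hy => aux_term lam s0 m δ hδ y n (hb y hy n))
  · intro z hz
    have := aux_iter lam hT s0 hS0 (m - 1) z hz
    rwa [Nat.sub_add_cancel hm] at this
  · intro θ hθ z hz
    exact aux_laplace lam hpos s0 hS0 m hm θ hθ z hz
  · intro A B hA hAB hB
    exact aux_gevrey lam hpos s0 hs0 hS hS1 m hm hS2 A B hA hAB hB
end

section
/- Let s_0 < 0 be real, g(t) = sinh(s_0)/(cosh t − cosh s_0), and let ε satisfy arg(−s_0 − 2πi) < −ε < 0, where arg(−s_0 − 2πi) ∈ (−π/2, 0). Then for every complex ρ with arg ρ ∈ (ε, π/2), both improper ray integrals below converge and ∫_0^{e^{−iε}∞} g(t) e^{iρ t} dt − ∫_0^{i∞} g(t) e^{iρ t} dt = −2πi e^{−i s_0 ρ} / (e^{2πρ} − 1) − 2πi e^{−i s_0 ρ}, where the integrals are taken over the rays of argument −ε and π/2 respectively. -/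
open Filter MeasureTheory Set
open scoped Topology Real

/-- The point `r e^{iθ}` of the ray of direction `θ`. -/
noncomputable def rayPt (θ r : ℝ) : ℂ := (r : ℂ) * Complex.exp ((θ : ℂ) * Complex.I)

/-- The unit direction `e^{iθ}`. -/
noncomputable def rayDir (θ : ℝ) : ℂ := Complex.exp ((θ : ℂ) * Complex.I)

/-- The kernel `g(t) = sinh(s₀)/(cosh t − cosh s₀)`. -/
noncomputable def gfun (s0 : ℝ) (t : ℂ) : ℂ :=
  Complex.sinh (s0 : ℂ) / (Complex.cosh t - Complex.cosh (s0 : ℂ))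

noncomputable def FF (s0 : ℝ) (ρ t : ℂ) : ℂ := gfun s0 t * Complex.exp (Complex.I * ρ * t)

lemma aux_seg (F Φ : ℂ → ℂ) (a v : ℂ) (s1 s2 : ℝ)
    (h : ∀ s ∈ uIcc s1 s2, HasDerivAt Φ (F (a + (s : ℂ) * v)) (a + (s : ℂ) * v))
    (hc : ∀ s ∈ uIcc s1 s2, ContinuousAt F (a + (s : ℂ) * v)) :
    ∫ s in s1..s2, F (a + (s : ℂ) * v) * v = Φ (a + (s2 : ℂ) * v) - Φ (a + (s1 : ℂ) * v) := by
  have := intervalIntegral.integral_eq_sub_of_hasDerivAt (a := s1) (b := s2)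
    (f := fun s : ℝ => Φ (a + (s : ℂ) * v)) (f' := fun s : ℝ => F (a + (s : ℂ) * v) * v) ?_ ?_
  · exact this
  · intro s hs
    have h1 : HasDerivAt (fun z : ℂ => a + z * v) v (s : ℂ) := by
      simpa using ((hasDerivAt_id (s : ℂ)).mul_const v).const_add a
    exact (HasDerivAt.comp (s : ℂ) (h s hs) h1).comp_ofReal
  · apply ContinuousOn.intervalIntegrable
    intro s hs
    apply ContinuousAt.continuousWithinAt
    apply ContinuousAt.mul _ continuousAt_const
    exact ContinuousAt.comp (f := fun s : ℝ => a + (s : ℂ) * v) (hc s hs) (by fun_prop)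

lemma aux_pole {s0 : ℝ} (_hs0 : s0 < 0) {t : ℂ} (h : Complex.cosh t = Complex.cosh (s0 : ℂ)) :
    (t.re = -s0 ∨ t.re = s0) ∧ ∃ k : ℤ, t.im = 2 * π * k := by
  rw [← Complex.cos_mul_I, ← Complex.cos_mul_I, Complex.cos_eq_cos_iff] at h
  obtain ⟨k, h | h⟩ := h
  · have h1 := congrArg Complex.re h
    have h2 := congrArg Complex.im h
    simp at h1 h2
    refine ⟨Or.inr h2.symm, k, ?_⟩
    linarith
  · have h1 := congrArg Complex.re h
    have h2 := congrArg Complex.im h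
    simp at h1 h2
    refine ⟨Or.inl (by linarith), -k, ?_⟩
    push_cast
    linarith

lemma aux_diff {s0 : ℝ} (ρ : ℂ) {t : ℂ} (h : Complex.cosh t ≠ Complex.cosh (s0 : ℂ)) :
    DifferentiableAt ℂ (FF s0 ρ) t := by
  unfold FF gfun
  have := sub_ne_zero.2 h
  apply DifferentiableAt.mul
  · exact DifferentiableAt.div (differentiableAt_const _)
      ((Complex.differentiable_cosh t).sub_const _) this
  · fun_prop

lemma aux_per (s0 : ℝ) (ρ t : ℂ) :
    FF s0 ρ (t + 2 * π * Complex.I) = Complex.exp (-(2 * π * ρ)) * FF s0 ρ t := by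
  unfold FF gfun
  have h1 : Complex.cosh (t + 2 * π * Complex.I) = Complex.cosh t := by
    rw [← Complex.cos_mul_I, ← Complex.cos_mul_I]
    rw [show (t + 2 * π * Complex.I) * Complex.I = t * Complex.I - 2 * π by
      linear_combination (2 * π : ℂ) * Complex.I_mul_I]
    exact Complex.cos_sub_two_pi _
  rw [h1, show Complex.I * ρ * (t + 2 * π * Complex.I) = -(2 * π * ρ) + Complex.I * ρ * t by
    linear_combination (2 * π * ρ : ℂ) * Complex.I_mul_I, Complex.exp_add]
  ring

lemma aux_bound_s16 (s0 : ℝ) (ρ : ℂ) (τ : ℝ) (hre : 0 < ρ.re) :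
    ∃ M : ℝ, 0 < M ∧ ∀ t : ℂ, M ≤ t.re → -(τ * t.re) ≤ t.im →
      ‖FF s0 ρ t‖ ≤ Real.exp (-(ρ.im - ρ.re * τ) * t.re) := by
  refine ⟨Real.cosh s0 + ‖Complex.sinh (s0 : ℂ)‖, by positivity, ?_⟩
  intro t ht him
  unfold FF gfun
  rw [norm_mul, Complex.norm_exp]
  have h0 : (0:ℝ) ≤ t.re := le_trans (by positivity) ht
  have h1 : Real.sinh t.re ≤ ‖Complex.cosh t‖ := by
    have e1 : Complex.cosh t = (Complex.exp t - (-Complex.exp (-t))) / 2 := by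
      rw [Complex.cosh]; ring
    have e2 := norm_sub_norm_le (Complex.exp t) (-Complex.exp (-t))
    rw [norm_neg, Complex.norm_exp, Complex.norm_exp] at e2
    rw [e1, norm_div, Real.sinh_eq]
    simp at e2 ⊢
    linarith
  have h2 : ‖Complex.cosh (s0 : ℂ)‖ = Real.cosh s0 := by
    rw [← Complex.ofReal_cosh, Complex.norm_real, Real.norm_of_nonneg (by positivity)]
  have h3 := norm_sub_norm_le (Complex.cosh t) (Complex.cosh (s0 : ℂ))
  have h4 : t.re ≤ Real.sinh t.re := Real.self_le_sinh_iff.2 h0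
  have h5 : ‖Complex.sinh (s0 : ℂ)‖ ≤ ‖Complex.cosh t - Complex.cosh (s0 : ℂ)‖ := by linarith
  have h6 : ‖Complex.sinh (s0 : ℂ) / (Complex.cosh t - Complex.cosh (s0 : ℂ))‖ ≤ 1 := by
    rw [norm_div]
    exact div_le_one_of_le₀ h5 (norm_nonneg _)
  have h7 : (Complex.I * ρ * t).re ≤ -(ρ.im - ρ.re * τ) * t.re := by
    simp
    nlinarith
  calc _ ≤ 1 * Real.exp (-(ρ.im - ρ.re * τ) * t.re) := by gcongr
    _ = _ := one_mul _

lemma aux_prim {U : Set ℂ} (hU : Convex ℝ U) (hUo : IsOpen U)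
    {f : ℂ → ℂ} (h : DifferentiableOn ℂ f U) :
    ∃ Φ : ℂ → ℂ, ∀ t ∈ U, HasDerivAt Φ (f t) t := by
  obtain ⟨Φ, hΦ⟩ := hU.exists_forall_hasDerivWithinAt h
  exact ⟨Φ, fun t ht => (hΦ t ht).hasDerivAt (hUo.mem_nhds ht)⟩

lemma aux_imag (s0 : ℝ) (hs0 : s0 < 0) (ρ : ℂ) (hre : 0 < ρ.re) :
    IntegrableOn (fun y : ℝ => FF s0 ρ (0 + (y : ℂ) * Complex.I) * Complex.I) (Ioi 0) ∧
    (1 - Complex.exp (-(2 * π * ρ))) *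
      (∫ y in Ioi (0:ℝ), FF s0 ρ (0 + (y : ℂ) * Complex.I) * Complex.I) =
      ∫ y in (0:ℝ)..(2 * π), FF s0 ρ (0 + (y : ℂ) * Complex.I) * Complex.I := by
  set f : ℝ → ℂ := fun y : ℝ => FF s0 ρ (0 + (y : ℂ) * Complex.I) * Complex.I with hf
  have hcont : Continuous f := by
    apply Continuous.mul _ continuous_const
    rw [continuous_iff_continuousAt]
    intro y
    apply ContinuousAt.comp (f := fun s : ℝ => 0 + (s : ℂ) * Complex.I) (g := FF s0 ρ) _ (by fun_prop)
    apply (aux_diff ρ _).continuousAt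
    intro h
    have := (aux_pole hs0 h).1
    simp at this
    rcases this with h | h <;> linarith
  have hperf : ∀ y, f (y + 2 * π) = Complex.exp (-(2 * π * ρ)) * f y := by
    intro y
    simp only [hf]
    rw [← mul_assoc, ← aux_per]
    congr 2
    push_cast; ring
  have hint : IntegrableOn f (Ioi 0) := by
    have hs1 : 1 < Real.cosh s0 := Real.one_lt_cosh.2 hs0.ne
    refine (integrable_norm_iff (hcont.aestronglyMeasurable)).1 ?_
    apply integrable_of_isBigO_exp_neg hre (hcont.norm.continuousOn)
    apply Asymptotics.IsBigO.of_bound (‖Complex.sinh (s0:ℂ)‖ / (Real.cosh s0 - 1))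
    refine Eventually.of_forall fun y => ?_
    simp only [hf, FF, gfun]
    rw [norm_norm, norm_mul, norm_mul, Complex.norm_I, mul_one, Complex.norm_exp, norm_div,
      Real.norm_of_nonneg (Real.exp_pos _).le, zero_add, Complex.cosh_mul_I]
    have e : ‖Complex.cos (y:ℂ) - Complex.cosh (s0:ℂ)‖ = Real.cosh s0 - Real.cos y := by
      rw [← Complex.ofReal_cos, ← Complex.ofReal_cosh, ← Complex.ofReal_sub, Complex.norm_real,
        Real.norm_eq_abs, abs_of_nonpos (by linarith [Real.cos_le_one y])]
      ring
    rw [e]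
    have : (Complex.I * ρ * (y * Complex.I)).re = -ρ.re * y := by
      simp
    rw [this]
    gcongr
    exact Real.cos_le_one y
  refine ⟨hint, ?_⟩
  have h1 := intervalIntegral.integral_interval_add_Ioi (b := 2 * π) hint
    (hint.mono_set (Ioi_subset_Ioi (by positivity)))
  have h2 : ∫ y in Ioi (2 * π), f y = Complex.exp (-(2 * π * ρ)) * ∫ y in Ioi (0:ℝ), f y := by
    rw [← integral_const_mul]
    simp_rw [← hperf]
    have := (measurePreserving_add_right volume (2 * π)).setIntegral_preimage_emb
      (measurableEmbedding_addRight (2 * π)) f (Ioi (2 * π))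
    rw [← this]
    simp
  rw [h2] at h1
  linear_combination -h1

lemma aux_tail {s0 τ : ℝ} {ρ : ℂ} {M : ℝ} (hM : ∀ t : ℂ, M ≤ t.re → -(τ * t.re) ≤ t.im →
      ‖FF s0 ρ t‖ ≤ Real.exp (-(ρ.im - ρ.re * τ) * t.re)) {Φ : ℂ → ℂ} {x y1 y2 : ℝ} (hx : M ≤ x)
    (h12 : y1 ≤ y2) (hy : -(τ * x) ≤ y1)
    (h : ∀ y ∈ Icc y1 y2, HasDerivAt Φ (FF s0 ρ (⟨x, y⟩ : ℂ)) ⟨x, y⟩) :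
    ‖Φ ⟨x, y2⟩ - Φ ⟨x, y1⟩‖ ≤ Real.exp (-(ρ.im - ρ.re * τ) * x) * (y2 - y1) := by
  have key := Convex.norm_image_sub_le_of_norm_hasDerivWithin_le (s := Icc y1 y2)
    (f := fun y : ℝ => Φ ((x : ℂ) + y * Complex.I))
    (f' := fun y : ℝ => FF s0 ρ ((x : ℂ) + y * Complex.I) * Complex.I)
    (C := Real.exp (-(ρ.im - ρ.re * τ) * x)) (x := y1) (y := y2) ?_ ?_ (convex_Icc _ _)
    (left_mem_Icc.2 h12) (right_mem_Icc.2 h12)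
  · simp only [Complex.mk_eq_add_mul_I]
    rwa [Real.norm_of_nonneg (sub_nonneg.2 h12)] at key
  · intro y hy
    have h1 : HasDerivAt (fun z : ℂ => (x : ℂ) + z * Complex.I) Complex.I (y : ℂ) := by
      simpa using ((hasDerivAt_id (y : ℂ)).mul_const Complex.I).const_add (x : ℂ)
    have h2 := h y hy
    simp only [Complex.mk_eq_add_mul_I] at h2
    exact (HasDerivAt.comp (y : ℂ) h2 h1).comp_ofReal.hasDerivWithinAt
  · intro y hy'
    rw [norm_mul, Complex.norm_I, mul_one]
    have := hM ((x : ℂ) + y * Complex.I) (by simpa using hx) (by simpa using hy.trans hy'.1)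
    simpa using this

lemma aux_rem_s16 {s0 : ℝ} (hs0 : s0 < 0) (ρ : ℂ) :
    ∃ h : ℂ → ℂ, DifferentiableOn ℂ h {t : ℂ | s0 < t.re ∧ -(2 * π) < t.im ∧ t.im < 2 * π} ∧
      ∀ t : ℂ, t ≠ -(s0:ℂ) → s0 < t.re → -(2 * π) < t.im → t.im < 2 * π →
        FF s0 ρ t = h t - Complex.exp (-(Complex.I * s0 * ρ)) * (t + s0)⁻¹ := by
  set U : Set ℂ := {t : ℂ | s0 < t.re ∧ -(2 * π) < t.im ∧ t.im < 2 * π} with hU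
  have hUo : IsOpen U := by
    apply (isOpen_lt continuous_const Complex.continuous_re).inter
    exact (isOpen_lt continuous_const Complex.continuous_im).inter
      (isOpen_lt Complex.continuous_im continuous_const)
  set p : ℂ := -(s0:ℂ) with hp
  have hpU : p ∈ U := by
    simp [hU, hp, hs0, Real.pi_pos]
  set N : ℂ → ℂ := fun t => Complex.cosh t - Complex.cosh (s0:ℂ) with hN
  have hNp : N p = 0 := by simp [hN, hp]
  have hsinh : Complex.sinh (s0:ℂ) ≠ 0 := by
    rw [← Complex.ofReal_sinh]
    exact_mod_cast (Real.sinh_neg_iff.2 hs0).ne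
  have hNd : HasDerivAt N (-Complex.sinh (s0:ℂ)) p := by
    have := (Complex.hasDerivAt_cosh p).sub_const (Complex.cosh (s0:ℂ))
    simpa only [hp, Complex.sinh_neg] using this
  have hNdiff : DifferentiableOn ℂ (dslope N p) U := by
    rw [Complex.differentiableOn_dslope (hUo.mem_nhds hpU)]
    exact (Complex.differentiable_cosh.sub_const _).differentiableOn
  have hne : ∀ t ∈ U, dslope N p t ≠ 0 := by
    intro t ht
    by_cases htp : t = p
    · rw [htp, dslope_same, hNd.deriv]
      simpa using hsinh
    · rw [dslope_of_ne _ htp, slope_def_field, hNp, sub_zero]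
      apply div_ne_zero _ (sub_ne_zero.2 htp)
      intro h0
      obtain ⟨h1, k, hk⟩ := aux_pole hs0 (sub_eq_zero.1 h0)
      obtain ⟨ha, hb, hc⟩ := ht
      have hpi := Real.pi_pos
      have hk0 : k = 0 := by
        rw [hk] at hb hc
        have h3 : (k:ℝ) < 1 := by nlinarith
        have h4 : (-1:ℝ) < k := by nlinarith
        have h3' : k < 1 := by exact_mod_cast h3
        have h4' : -1 < k := by exact_mod_cast h4
        omega
      apply htp
      apply Complex.ext
      · rcases h1 with h1 | h1
        · simp [hp, h1]
        · linarith
      · rw [hk, hk0, hp]; simp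
  set K : ℂ → ℂ := fun t => Complex.sinh (s0:ℂ) * Complex.exp (Complex.I * ρ * t) / dslope N p t
    with hK
  have hKd : DifferentiableOn ℂ K U := by
    apply DifferentiableOn.div _ hNdiff hne
    fun_prop
  have hKp : K p = -Complex.exp (-(Complex.I * s0 * ρ)) := by
    simp only [hK, dslope_same, hNd.deriv]
    rw [hp]
    rw [show Complex.I * ρ * -(s0:ℂ) = -(Complex.I * s0 * ρ) by ring]
    field_simp
  refine ⟨dslope K p, (Complex.differentiableOn_dslope (hUo.mem_nhds hpU)).2 hKd, ?_⟩
  intro t htp h1 h2 h3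
  have htp' : t - p ≠ 0 := sub_ne_zero.2 htp
  have hNt : N t ≠ 0 := by
    have := hne t ⟨h1, h2, h3⟩
    rw [dslope_of_ne _ htp, slope_def_field, hNp, sub_zero] at this
    intro h; rw [h] at this; simp at this
  rw [dslope_of_ne _ htp, slope_def_field, hKp]
  simp only [hK]
  rw [dslope_of_ne _ htp, slope_def_field, hNp, sub_zero]
  have e1 : t + s0 = t - p := by simp [hp]
  rw [e1]
  unfold FF gfun
  change Complex.sinh (s0:ℂ) / N t * _ = _
  field_simp
  ring

lemma aux_hor (F Φ : ℂ → ℂ) (y x1 x2 : ℝ)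
    (h : ∀ x ∈ uIcc x1 x2, HasDerivAt Φ (F ⟨x, y⟩) ⟨x, y⟩)
    (hc : ∀ x ∈ uIcc x1 x2, ContinuousAt F ⟨x, y⟩) :
    ∫ x in x1..x2, F ⟨x, y⟩ = Φ ⟨x2, y⟩ - Φ ⟨x1, y⟩ := by
  have e : ∀ x : ℝ, (⟨x, y⟩ : ℂ) = (y : ℂ) * Complex.I + (x : ℂ) * 1 := by
    intro x; rw [Complex.mk_eq_add_mul_I]; ring
  simp only [e] at h hc ⊢
  simpa using aux_seg F Φ _ 1 x1 x2 h hc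

lemma aux_ver (F Φ : ℂ → ℂ) (x y1 y2 : ℝ)
    (h : ∀ y ∈ uIcc y1 y2, HasDerivAt Φ (F ⟨x, y⟩) ⟨x, y⟩)
    (hc : ∀ y ∈ uIcc y1 y2, ContinuousAt F ⟨x, y⟩) :
    ∫ y in y1..y2, F ⟨x, y⟩ * Complex.I = Φ ⟨x, y2⟩ - Φ ⟨x, y1⟩ := by
  simp only [Complex.mk_eq_add_mul_I] at h hc ⊢
  simpa using aux_seg F Φ _ Complex.I y1 y2 h hc

lemma aux_log_up {w : ℂ} (h : 0 < w.im) : Complex.log w - Complex.log (-w) = π * Complex.I := by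
  rw [Complex.log, Complex.log, Complex.arg_neg_eq_arg_sub_pi_of_im_pos h, norm_neg]
  push_cast; ring

lemma aux_log_down {w : ℂ} (h : w.im < 0) :
    Complex.log w - Complex.log (-w) = -(π * Complex.I) := by
  rw [Complex.log, Complex.log, Complex.arg_neg_eq_arg_add_pi_of_im_neg h, norm_neg]
  push_cast; ring

lemma aux_res {s0 : ℝ} (hs0 : s0 < 0) (ρ : ℂ) :
    ∃ Ψ : ℂ → ℂ, (∀ t : ℂ, s0 < t.re → -(2 * π) < t.im → t.im < 2 * π →
        t + s0 ∈ Complex.slitPlane → HasDerivAt Ψ (FF s0 ρ t) t) ∧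
      ∀ x0 c : ℝ, s0 < x0 → x0 < -s0 → 0 < c → c < 2 * π → ∀ Φ : ℂ → ℂ,
        (∀ t : ℂ, s0 < t.re → t.re < -s0 → HasDerivAt Φ (FF s0 ρ t) t) →
        Ψ ⟨x0, 2 * π - c⟩ - Ψ ⟨x0, -c⟩ = Φ ⟨x0, 2 * π - c⟩ - Φ ⟨x0, -c⟩
          - 2 * π * Complex.I * Complex.exp (-(Complex.I * s0 * ρ)) := by
  obtain ⟨h, hd, hF⟩ := aux_rem_s16 hs0 ρ
  have hUo : IsOpen {t : ℂ | s0 < t.re ∧ -(2 * π) < t.im ∧ t.im < 2 * π} := by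
    apply (isOpen_lt continuous_const Complex.continuous_re).inter
    exact (isOpen_lt continuous_const Complex.continuous_im).inter
      (isOpen_lt Complex.continuous_im continuous_const)
  have hUc : Convex ℝ {t : ℂ | s0 < t.re ∧ -(2 * π) < t.im ∧ t.im < 2 * π} :=
    (convex_halfSpace_re_gt s0).inter
      ((convex_halfSpace_im_gt _).inter (convex_halfSpace_im_lt _))
  obtain ⟨H, hH⟩ := aux_prim hUc hUo hd
  set E := Complex.exp (-(Complex.I * s0 * ρ)) with hE
  refine ⟨fun t => H t - E * Complex.log (t + s0), ?_, ?_⟩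
  · intro t h1 h2 h3 h4
    have hne : t ≠ -(s0:ℂ) := by
      intro h; rw [h] at h4; simp at h4
    rw [hF t hne h1 h2 h3]
    refine (hH t ⟨h1, h2, h3⟩).sub (HasDerivAt.const_mul E ?_)
    have := ((hasDerivAt_id t).add_const (s0:ℂ)).clog h4
    simpa using this
  · intro x0 c hx0 hx0' hc hc' Φ hΦ
    have hcont : ∀ y ∈ uIcc (-c) (2 * π - c), ContinuousAt (FF s0 ρ) ⟨x0, y⟩ := by
      intro y hy
      apply (aux_diff ρ _).continuousAt
      intro hh
      rcases (aux_pole hs0 hh).1 with h | h <;> simp at h <;> linarith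
    have hpi := Real.pi_pos
    have e1 := aux_ver (FF s0 ρ) Φ x0 (-c) (2 * π - c) (fun y _ => hΦ _ hx0 hx0') hcont
    have e2 := aux_ver (FF s0 ρ) (fun t => H t - E * Complex.log (-(t + s0))) x0 (-c) (2 * π - c)
      ?_ hcont
    · rw [e1] at e2
      rw [e2]
      have l1 := aux_log_up (w := (⟨x0, 2 * π - c⟩ : ℂ) + s0) (by simp; linarith)
      have l2 := aux_log_down (w := (⟨x0, -c⟩ : ℂ) + s0) (by simp; linarith)
      linear_combination (-E) * l1 + E * l2
    · intro y hy
      rw [uIcc_of_le (by linarith)] at hy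
      have hne : (⟨x0, y⟩ : ℂ) ≠ -(s0:ℂ) := by
        intro h
        have := congrArg Complex.re h
        simp at this; linarith
      have b1 : -(2 * π) < y := by linarith [hy.1]
      have b2 : y < 2 * π := by linarith [hy.2]
      rw [hF _ hne hx0 b1 b2]
      refine (hH ⟨x0, y⟩ ⟨hx0, b1, b2⟩).sub (HasDerivAt.const_mul E ?_)
      have := (((hasDerivAt_id (⟨x0, y⟩ : ℂ)).add_const (s0:ℂ)).neg).clog
        (by left; simp; linarith)
      have e : (-1 : ℂ) / (-(⟨x0, y⟩ + (s0:ℂ))) = (⟨x0, y⟩ + (s0:ℂ))⁻¹ := by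
        rw [neg_div_neg_eq, one_div]
      rw [← e]
      exact this

theorem aux_core (s0 : ℝ) (hs0 : s0 < 0) (τ : ℝ) (hτ : 0 < τ) (hsτ : -s0 * τ < 2 * π) (ρ : ℂ)
    (hre : 0 < ρ.re) (hδ : ρ.re * τ < ρ.im) :
    IntegrableOn (fun x : ℝ => FF s0 ρ (0 + (x : ℂ) * ⟨1, -τ⟩) * ⟨1, -τ⟩) (Ioi 0) ∧
    (∫ x in Ioi (0:ℝ), FF s0 ρ (0 + (x : ℂ) * ⟨1, -τ⟩) * ⟨1, -τ⟩) -
      (∫ y in Ioi (0:ℝ), FF s0 ρ (0 + (y : ℂ) * Complex.I) * Complex.I) =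
      -(2 * π * Complex.I * Complex.exp (-(Complex.I * s0 * ρ))) /
        (1 - Complex.exp (-(2 * π * ρ))) := by
  have hpi := Real.pi_pos
  set w : ℂ := ⟨1, -τ⟩ with hw
  set E := Complex.exp (-(Complex.I * s0 * ρ)) with hE
  set q := Complex.exp (-(2 * π * ρ)) with hq
  set δ := ρ.im - ρ.re * τ with hδd
  have hδ0 : 0 < δ := by linarith
  have hq1 : 1 - q ≠ 0 := by
    intro h
    have h1 : q = 1 := by linear_combination -h
    have h2 : ‖q‖ < 1 := by
      rw [hq, Complex.norm_exp, Real.exp_lt_one_iff]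
      simp
      positivity
    rw [h1] at h2
    simp at h2
  have hxw : ∀ x : ℝ, 0 + (x : ℂ) * w = ⟨x, -(τ * x)⟩ := by
    intro x
    apply Complex.ext <;> simp [hw]
    ring
  -- pole free facts
  have hstrip : ∀ t : ℂ, s0 < t.re → t.re < -s0 → DifferentiableAt ℂ (FF s0 ρ) t := by
    intro t h1 h2
    apply aux_diff
    intro hh
    rcases (aux_pole hs0 hh).1 with h | h <;> linarith
  have hlow : ∀ t : ℂ, t.im < 0 → -(2 * π + s0 * τ) < t.im + τ * t.re →
      DifferentiableAt ℂ (FF s0 ρ) t := by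
    intro t h1 h2
    apply aux_diff
    intro hh
    obtain ⟨h3, k, hk⟩ := aux_pole hs0 hh
    have hk0 : (k:ℝ) < 0 := by
      by_contra hc
      push Not at hc
      have : 0 ≤ 2 * π * k := by positivity
      linarith
    have hk1 : (k:ℝ) ≤ -1 := by
      have : k < 0 := by exact_mod_cast hk0
      exact_mod_cast (by omega : k ≤ -1)
    have hre' : t.re ≤ -s0 := by rcases h3 with h | h <;> linarith
    nlinarith
  have hrayd : ∀ x : ℝ, 0 ≤ x → DifferentiableAt ℂ (FF s0 ρ) ⟨x, -(τ * x)⟩ := by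
    intro x hx
    by_cases h : x < -s0
    · exact hstrip _ (by simp; linarith) h
    · apply hlow
      · simp; nlinarith
      · simp; linarith
  obtain ⟨M, hM0, hM⟩ := aux_bound_s16 s0 ρ τ hre
  -- integrability on the ray
  have hcontray : ContinuousOn (fun x : ℝ => FF s0 ρ (0 + (x : ℂ) * w) * w) (Ici 0) := by
    intro x hx
    apply ContinuousAt.continuousWithinAt
    apply ContinuousAt.mul _ continuousAt_const
    apply ContinuousAt.comp (f := fun x : ℝ => 0 + (x : ℂ) * w) (g := FF s0 ρ) _ (by fun_prop)
    rw [hxw]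
    exact (hrayd x hx).continuousAt
  have hint : IntegrableOn (fun x : ℝ => FF s0 ρ (0 + (x : ℂ) * w) * w) (Ioi 0) := by
    refine (integrable_norm_iff ((hcontray.mono Ioi_subset_Ici_self).aestronglyMeasurable
      measurableSet_Ioi)).1 ?_
    apply integrable_of_isBigO_exp_neg hδ0 hcontray.norm
    apply Asymptotics.IsBigO.of_bound ‖w‖
    filter_upwards [eventually_ge_atTop M] with x hx
    rw [norm_norm, norm_mul, hxw, mul_comm, Real.norm_of_nonneg (Real.exp_pos _).le]
    gcongr
    exact hM ⟨x, -(τ * x)⟩ hx le_rfl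
  refine ⟨hint, ?_⟩
  obtain ⟨hBint, hB⟩ := aux_imag s0 hs0 ρ hre
  -- primitives
  obtain ⟨Φ1, hΦ1⟩ := aux_prim (U := {t : ℂ | s0 < t.re ∧ t.re < -s0}) (f := FF s0 ρ)
    ((convex_halfSpace_re_gt s0).inter (convex_halfSpace_re_lt _))
    ((isOpen_lt continuous_const Complex.continuous_re).inter
      (isOpen_lt Complex.continuous_re continuous_const))
    (fun t ht => (hstrip t ht.1 ht.2).differentiableWithinAt)
  have hlin : IsLinearMap ℝ (fun t : ℂ => t.im + τ * t.re) := by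
    constructor
    · intro a b; simp; ring
    · intro a b; simp; ring
  obtain ⟨Φ2, hΦ2⟩ := aux_prim
    (U := {t : ℂ | t.im < 0 ∧ -(2 * π + s0 * τ) < t.im + τ * t.re}) (f := FF s0 ρ)
    ((convex_halfSpace_im_lt 0).inter (convex_halfSpace_gt hlin _))
    ((isOpen_lt Complex.continuous_im continuous_const).inter
      (isOpen_lt continuous_const
        (Complex.continuous_im.add (continuous_const.mul Complex.continuous_re))))
    (fun t ht => (hlow t ht.1 ht.2).differentiableWithinAt)
  obtain ⟨Ψ, hΨ, hres⟩ := aux_res hs0 ρ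
  set x0 : ℝ := -s0 / 2 with hx0
  set c : ℝ := τ * x0 with hcd
  have hx0pos : 0 < x0 := by rw [hx0]; linarith
  have hx0lt : x0 < -s0 := by rw [hx0]; linarith
  have hc0 : 0 < c := by positivity
  have hc1 : c < 2 * π := by rw [hcd, hx0]; nlinarith
  have hres1 := hres x0 c (by linarith) hx0lt hc0 hc1 Φ1 (fun t h1 h2 => hΦ1 t ⟨h1, h2⟩)
  -- periodicity of Φ1 difference
  have hper : ∀ x y : ℝ, FF s0 ρ ⟨x, y + 2 * π⟩ = q * FF s0 ρ ⟨x, y⟩ := by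
    intro x y
    rw [← aux_per]
    congr 1
    apply Complex.ext <;> simp
  have hPhi : Φ1 ⟨x0, 2 * π - c⟩ - Φ1 ⟨0, 2 * π⟩ = q * (Φ1 ⟨x0, -c⟩ - Φ1 ⟨0, 0⟩) := by
    have hmem : ∀ x ∈ uIcc 0 1, s0 < x * x0 ∧ x * x0 < -s0 := by
      intro x hx
      rw [uIcc_of_le zero_le_one] at hx
      constructor <;> nlinarith [hx.1, hx.2]
    have e : ∀ y x : ℝ, (⟨0, y⟩ : ℂ) + (x : ℂ) * ⟨x0, -c⟩ = ⟨x * x0, y - x * c⟩ := by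
      intro y x
      apply Complex.ext <;> simp
      ring
    have e1 := aux_seg (FF s0 ρ) Φ1 ⟨0, 2 * π⟩ ⟨x0, -c⟩ 0 1
      (fun x hx => by rw [e]; exact hΦ1 _ (hmem x hx))
      (fun x hx => by rw [e]; exact (hstrip _ (hmem x hx).1 (hmem x hx).2).continuousAt)
    have e2 := aux_seg (FF s0 ρ) Φ1 ⟨0, 0⟩ ⟨x0, -c⟩ 0 1
      (fun x hx => by rw [e]; exact hΦ1 _ (hmem x hx))
      (fun x hx => by rw [e]; exact (hstrip _ (hmem x hx).1 (hmem x hx).2).continuousAt)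
    have e3 : ∀ x : ℝ, FF s0 ρ (⟨0, 2 * π⟩ + (x : ℂ) * ⟨x0, -c⟩) * ⟨x0, -c⟩ =
        q * (FF s0 ρ (⟨0, 0⟩ + (x : ℂ) * ⟨x0, -c⟩) * ⟨x0, -c⟩) := by
      intro x
      rw [e, e]
      have := hper (x * x0) (0 - x * c)
      rw [show 0 - x * c + 2 * π = 2 * π - x * c by ring] at this
      rw [this, mul_assoc]
    simp only [e3] at e1
    rw [intervalIntegral.integral_const_mul, e2] at e1
    simp only [e] at e1
    simp at e1
    rw [e1]
  have hB1 : (∫ y in (0:ℝ)..(2 * π), FF s0 ρ (0 + (y : ℂ) * Complex.I) * Complex.I) =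
      Φ1 ⟨0, 2 * π⟩ - Φ1 ⟨0, 0⟩ := by
    have := aux_ver (FF s0 ρ) Φ1 0 0 (2 * π) (fun y _ => hΦ1 _ ⟨hs0, by simpa using hs0⟩)
      (fun y _ => (hstrip _ hs0 (by simpa using hs0)).continuousAt)
    simpa only [Complex.mk_eq_add_mul_I, Complex.ofReal_zero] using this
  -- horizontal integrals
  set D : ℝ → ℂ := fun X => ∫ x in x0..X, FF s0 ρ ⟨x, -c⟩ with hD
  have hlowhor : ∀ x, x0 ≤ x → (⟨x, -c⟩ : ℂ) ∈
      {t : ℂ | t.im < 0 ∧ -(2 * π + s0 * τ) < t.im + τ * t.re} := by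
    intro x hx
    refine ⟨by simpa using hc0, ?_⟩
    simp only [hcd]
    nlinarith
  have hD1 : ∀ X, x0 ≤ X → D X = Ψ ⟨X, -c⟩ - Ψ ⟨x0, -c⟩ := by
    intro X hX
    apply aux_hor
    · intro x hx
      rw [uIcc_of_le hX] at hx
      refine hΨ _ (by simp; linarith [hx.1]) (by simpa using hc1) (by simp; linarith) ?_
      right; simpa using hc0.ne'
    · intro x hx
      rw [uIcc_of_le hX] at hx
      exact (hlow _ (hlowhor x hx.1).1 (hlowhor x hx.1).2).continuousAt
  have hD2 : ∀ X, x0 ≤ X → q * D X = Ψ ⟨X, 2 * π - c⟩ - Ψ ⟨x0, 2 * π - c⟩ := by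
    intro X hX
    rw [hD]
    simp only
    rw [← intervalIntegral.integral_const_mul]
    simp_rw [← hper]
    rw [show -c + 2 * π = 2 * π - c by ring]
    apply aux_hor
    · intro x hx
      rw [uIcc_of_le hX] at hx
      refine hΨ _ (by simp; linarith [hx.1]) (by simp; linarith) (by simpa using hc0) ?_
      right; simp; linarith
    · intro x hx
      apply (aux_diff ρ _).continuousAt
      intro hh
      obtain ⟨-, k, hk⟩ := aux_pole hs0 hh
      simp at hk
      have h3 : (k:ℝ) < 1 := by nlinarith
      have h4 : (0:ℝ) < k := by
        by_contra h; push Not at h; nlinarith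
      have h3' : k < 1 := by exact_mod_cast h3
      have h4' : 0 < k := by exact_mod_cast h4
      omega
  have hD3 : ∀ X, x0 ≤ X → D X = Φ2 ⟨X, -c⟩ - Φ2 ⟨x0, -c⟩ := by
    intro X hX
    apply aux_hor
    · intro x hx
      rw [uIcc_of_le hX] at hx
      exact hΦ2 _ (hlowhor x hx.1)
    · intro x hx
      rw [uIcc_of_le hX] at hx
      exact (hlow _ (hlowhor x hx.1).1 (hlowhor x hx.1).2).continuousAt
  have hexp : Tendsto (fun X : ℝ => Real.exp (-δ * X) * (2 * π)) atTop (𝓝 0) := by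
    have : Tendsto (fun X : ℝ => Real.exp (-δ * X)) atTop (𝓝 0) := by
      apply Real.tendsto_exp_atBot.comp
      exact tendsto_id.const_mul_atTop_of_neg (by linarith)
    simpa using this.mul_const (2 * π)
  have hexp2 : Tendsto (fun X : ℝ => Real.exp (-δ * X) * (τ * X)) atTop (𝓝 0) := by
    have := (Real.tendsto_pow_mul_exp_neg_atTop_nhds_zero 1).comp
      (tendsto_id.const_mul_atTop hδ0)
    have := this.const_mul (τ / δ)
    rw [mul_zero] at this
    refine this.congr fun X => ?_
    simp
    field_simp
  -- right edge
  have hright : Tendsto (fun X : ℝ => Ψ ⟨X, 2 * π - c⟩ - Ψ ⟨X, -c⟩) atTop (𝓝 0) := by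
    apply squeeze_zero_norm' _ hexp
    filter_upwards [eventually_ge_atTop M, eventually_gt_atTop (-s0)] with X hX hX2
    have := aux_tail hM (Φ := Ψ) (x := X) (y1 := -c) (y2 := 2 * π - c) hX (by linarith)
      (by rw [hcd]; nlinarith) ?_
    · rwa [show 2 * π - c - -c = 2 * π by ring] at this
    · intro y hy
      refine hΨ _ (by simp; linarith) (by simp; linarith [hy.1]) (by simp; linarith [hy.2]) ?_
      left; simp; linarith
  have hDlim : Tendsto D atTop
      (𝓝 ((Φ1 ⟨x0, 2 * π - c⟩ - Φ1 ⟨x0, -c⟩ - 2 * π * Complex.I * E) / (1 - q))) := by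
    have h1 : Tendsto (fun X : ℝ => (Φ1 ⟨x0, 2 * π - c⟩ - Φ1 ⟨x0, -c⟩ - 2 * π * Complex.I * E
        - (Ψ ⟨X, 2 * π - c⟩ - Ψ ⟨X, -c⟩)) / (1 - q)) atTop
        (𝓝 ((Φ1 ⟨x0, 2 * π - c⟩ - Φ1 ⟨x0, -c⟩ - 2 * π * Complex.I * E - 0) / (1 - q))) :=
      (hright.const_sub _).div_const _
    rw [sub_zero] at h1
    refine h1.congr' ?_
    filter_upwards [eventually_ge_atTop x0] with X hX
    rw [div_eq_iff hq1]
    linear_combination (-1 : ℂ) * hD1 X hX + hD2 X hX - hres1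
  -- the ray
  have hray1 : (∫ x in (0:ℝ)..x0, FF s0 ρ (0 + (x : ℂ) * w) * w) = Φ1 ⟨x0, -c⟩ - Φ1 ⟨0, 0⟩ := by
    have := aux_seg (FF s0 ρ) Φ1 0 w 0 x0 ?_ ?_
    · rw [this, hxw, hxw]; simp [hcd]
    · intro x hx
      rw [uIcc_of_le hx0pos.le] at hx
      rw [hxw]
      exact hΦ1 _ ⟨by simp; linarith [hx.1], by simp; linarith [hx.2]⟩
    · intro x hx
      rw [uIcc_of_le hx0pos.le] at hx
      rw [hxw]
      exact (hrayd x hx.1).continuousAt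
  have hray2 : ∀ X, x0 ≤ X → (∫ x in x0..X, FF s0 ρ (0 + (x : ℂ) * w) * w) =
      Φ2 ⟨X, -(τ * X)⟩ - Φ2 ⟨x0, -c⟩ := by
    intro X hX
    have := aux_seg (FF s0 ρ) Φ2 0 w x0 X ?_ ?_
    · rw [this, hxw, hxw]
    · intro x hx
      rw [uIcc_of_le hX] at hx
      rw [hxw]
      refine hΦ2 _ ⟨?_, ?_⟩
      · simp; nlinarith [hx.1]
      · simp; linarith
    · intro x hx
      rw [uIcc_of_le hX] at hx
      rw [hxw]
      exact (hrayd x (by linarith [hx.1])).continuousAt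
  have hedge : Tendsto (fun X : ℝ => Φ2 ⟨X, -c⟩ - Φ2 ⟨X, -(τ * X)⟩) atTop (𝓝 0) := by
    apply squeeze_zero_norm' _ hexp2
    filter_upwards [eventually_ge_atTop M, eventually_ge_atTop x0] with X hX hX2
    have hcX : c ≤ τ * X := by rw [hcd]; nlinarith
    have := aux_tail hM (Φ := Φ2) (x := X) (y1 := -(τ * X)) (y2 := -c) hX (by linarith) le_rfl ?_
    · refine this.trans ?_
      gcongr
      linarith
    · intro y hy
      refine hΦ2 _ ⟨by simp; linarith [hy.2], ?_⟩
      simp; linarith [hy.1]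
  have hAlim := intervalIntegral_tendsto_integral_Ioi 0 hint tendsto_id
  have hAlim2 : Tendsto (fun X : ℝ => (Φ1 ⟨x0, -c⟩ - Φ1 ⟨0, 0⟩) + (D X -
      (Φ2 ⟨X, -c⟩ - Φ2 ⟨X, -(τ * X)⟩))) atTop
      (𝓝 ((Φ1 ⟨x0, -c⟩ - Φ1 ⟨0, 0⟩) + ((Φ1 ⟨x0, 2 * π - c⟩ - Φ1 ⟨x0, -c⟩
        - 2 * π * Complex.I * E) / (1 - q) - 0))) :=
    (hDlim.sub hedge).const_add _
  have hA := tendsto_nhds_unique hAlim (hAlim2.congr' ?_)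
  · rw [hA]
    have hBv : (∫ y in Ioi (0:ℝ), FF s0 ρ (0 + (y : ℂ) * Complex.I) * Complex.I) =
        (Φ1 ⟨0, 2 * π⟩ - Φ1 ⟨0, 0⟩) / (1 - q) := by
      rw [eq_div_iff hq1, mul_comm, hB, hB1]
    rw [hBv]
    field_simp
    linear_combination hPhi
  · filter_upwards [eventually_ge_atTop x0] with X hX
    have hi : ∀ a b : ℝ, 0 ≤ a → a ≤ b →
        IntervalIntegrable (fun x : ℝ => FF s0 ρ (0 + (x : ℂ) * w) * w) volume a b := by
      intro a b ha hab
      apply ContinuousOn.intervalIntegrable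
      apply hcontray.mono
      rw [uIcc_of_le hab]
      exact fun x hx => ha.trans hx.1
    rw [id, ← intervalIntegral.integral_add_adjacent_intervals (hi 0 x0 le_rfl hx0pos.le)
      (hi x0 X hx0pos.le hX), hray1, hray2 X hX, hD3 X hX]
    ring

/-- For `s₀ < 0` and `ε` with `arg(−s₀ − 2πi) < −ε < 0`, and every `ρ`
with `arg ρ ∈ (ε, π/2)`, the ray integrals of `g(t) e^{iρt}` along the directions `−ε`
and `π/2` both converge, and
`∫_0^{e^{-iε}∞} g e^{iρt} dt − ∫_0^{i∞} g e^{iρt} dt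
  = −2πi e^{−is₀ρ}/(e^{2πρ} − 1) − 2πi e^{−is₀ρ}`. -/
theorem stmt_16 (s0 : ℝ) (hs0 : s0 < 0) (ε : ℝ)
    (hε : Complex.arg (-(s0 : ℂ) - 2 * (π : ℂ) * Complex.I) < -ε) (hε2 : 0 < ε)
    (ρ : ℂ) (hρ : Complex.arg ρ ∈ Set.Ioo ε (π / 2)) :
    IntegrableOn
      (fun r : ℝ =>
        gfun s0 (rayPt (-ε) r) * Complex.exp (Complex.I * ρ * rayPt (-ε) r) *
          rayDir (-ε)) (Set.Ioi 0) ∧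
    IntegrableOn
      (fun r : ℝ =>
        gfun s0 (rayPt (π / 2) r) * Complex.exp (Complex.I * ρ * rayPt (π / 2) r) *
          rayDir (π / 2)) (Set.Ioi 0) ∧
    (∫ r in Set.Ioi (0 : ℝ),
        gfun s0 (rayPt (-ε) r) * Complex.exp (Complex.I * ρ * rayPt (-ε) r) *
          rayDir (-ε))
      - (∫ r in Set.Ioi (0 : ℝ),
          gfun s0 (rayPt (π / 2) r) * Complex.exp (Complex.I * ρ * rayPt (π / 2) r) *
            rayDir (π / 2))
      = -(2 * (π : ℂ) * Complex.I) * Complex.exp (-(Complex.I * (s0 : ℂ) * ρ)) /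
            (Complex.exp (2 * (π : ℂ) * ρ) - 1)
        - 2 * (π : ℂ) * Complex.I * Complex.exp (-(Complex.I * (s0 : ℂ) * ρ)) := by
  have hpi := Real.pi_pos
  obtain ⟨hρ1, hρ2⟩ := hρ
  have hε3 : ε < π / 2 := hρ1.trans hρ2
  have hC : 0 < Real.cos ε := Real.cos_pos_of_mem_Ioo ⟨by linarith, hε3⟩
  have hS : 0 < Real.sin ε := Real.sin_pos_of_pos_of_lt_pi hε2 (by linarith)
  have hρ0 : ρ ≠ 0 := by
    intro h; rw [h, Complex.arg_zero] at hρ1; linarith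
  have hρn : 0 < ‖ρ‖ := norm_pos_iff.2 hρ0
  have hre : 0 < ρ.re := by
    rw [← Complex.norm_mul_cos_arg ρ]
    exact mul_pos hρn (Real.cos_pos_of_mem_Ioo ⟨by linarith, hρ2⟩)
  have hδ : ρ.re * Real.tan ε < ρ.im := by
    rw [Real.tan_eq_sin_div_cos, ← mul_div_assoc, div_lt_iff₀ hC]
    have h1 : 0 < Real.sin (Complex.arg ρ - ε) :=
      Real.sin_pos_of_pos_of_lt_pi (by linarith) (by linarith)
    rw [Real.sin_sub] at h1
    rw [← Complex.norm_mul_cos_arg ρ, ← Complex.norm_mul_sin_arg ρ]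
    nlinarith
  have hsτ : -s0 * Real.tan ε < 2 * π := by
    rw [Real.tan_eq_sin_div_cos, ← mul_div_assoc, div_lt_iff₀ hC]
    set z : ℂ := -(s0 : ℂ) - 2 * (π : ℂ) * Complex.I with hz
    have zre : z.re = -s0 := by simp [hz]
    have zim : z.im = -(2 * π) := by simp [hz]
    have hz0 : 0 < ‖z‖ := by
      apply norm_pos_iff.2
      intro h
      rw [h] at zre
      simp at zre
      linarith
    have h1 : -(π / 2) < z.arg := by
      rw [Complex.neg_pi_div_two_lt_arg_iff]
      left; rw [zre]; linarith
    have h2 : Real.sin (z.arg + ε) < 0 :=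
      Real.sin_neg_of_neg_of_neg_pi_lt (by linarith) (by linarith)
    rw [Real.sin_add] at h2
    have h3 := Complex.norm_mul_cos_arg z
    have h4 := Complex.norm_mul_sin_arg z
    rw [zre] at h3
    rw [zim] at h4
    have h5 : ‖z‖ * (Real.sin z.arg * Real.cos ε + Real.cos z.arg * Real.sin ε) < 0 :=
      mul_neg_of_pos_of_neg hz0 h2
    have h6 : ‖z‖ * (Real.sin z.arg * Real.cos ε + Real.cos z.arg * Real.sin ε) =
        -(2 * π) * Real.cos ε + -s0 * Real.sin ε := by
      rw [← h3, ← h4]; ring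
    linarith
  obtain ⟨hI1, hI2⟩ := aux_core s0 hs0 (Real.tan ε) (Real.tan_pos_of_pos_of_lt_pi_div_two hε2 hε3)
    hsτ ρ hre hδ
  have hB := (aux_imag s0 hs0 ρ hre).1
  have hdir : rayDir (-ε) = (Real.cos ε : ℂ) * ⟨1, -Real.tan ε⟩ := by
    unfold rayDir
    rw [Complex.exp_mul_I, ← Complex.ofReal_cos, ← Complex.ofReal_sin, Real.cos_neg, Real.sin_neg]
    apply Complex.ext
    · simp [-Complex.ofReal_cos, -Complex.ofReal_sin]
    · simp [-Complex.ofReal_cos, -Complex.ofReal_sin]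
      rw [mul_comm, Real.tan_mul_cos hC.ne']
  have hpt : ∀ θ r : ℝ, rayPt θ r = r * rayDir θ := fun _ _ => rfl
  have hdir2 : rayDir (π / 2) = Complex.I := by
    unfold rayDir
    push_cast
    exact Complex.exp_pi_div_two_mul_I
  have e1 : (fun r : ℝ => gfun s0 (rayPt (-ε) r) * Complex.exp (Complex.I * ρ * rayPt (-ε) r) *
      rayDir (-ε)) = fun r : ℝ => (Real.cos ε : ℂ) *
        (fun x : ℝ => FF s0 ρ (0 + (x : ℂ) * ⟨1, -Real.tan ε⟩) * ⟨1, -Real.tan ε⟩)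
          (Real.cos ε * r) := by
    funext r
    have e : rayPt (-ε) r = 0 + ((Real.cos ε * r : ℝ) : ℂ) * ⟨1, -Real.tan ε⟩ := by
      rw [hpt, hdir]; push_cast; ring
    simp only [FF]
    rw [e, hdir]
    ring
  have e2 : (fun r : ℝ => gfun s0 (rayPt (π / 2) r) *
      Complex.exp (Complex.I * ρ * rayPt (π / 2) r) * rayDir (π / 2)) =
      fun r : ℝ => FF s0 ρ (0 + (r : ℂ) * Complex.I) * Complex.I := by
    funext r
    simp only [FF]
    rw [hpt, hdir2, zero_add]
  rw [e1, e2]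
  refine ⟨?_, hB, ?_⟩
  · apply Integrable.const_mul
    have := (integrableOn_Ioi_comp_mul_left_iff
      (fun x : ℝ => FF s0 ρ (0 + (x : ℂ) * ⟨1, -Real.tan ε⟩) * ⟨1, -Real.tan ε⟩) 0 hC).2
      (by simpa using hI1)
    exact this
  · rw [integral_const_mul, integral_comp_mul_left_Ioi
      (fun x : ℝ => FF s0 ρ (0 + (x : ℂ) * ⟨1, -Real.tan ε⟩) * ⟨1, -Real.tan ε⟩) 0 hC, mul_zero]
    have hCne : (Real.cos ε : ℂ) ≠ 0 := by exact_mod_cast hC.ne'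
    rw [Complex.real_smul, ← mul_assoc, Complex.ofReal_inv, mul_inv_cancel₀ hCne, one_mul, hI2]
    have hq : Complex.exp (2 * π * ρ) - 1 ≠ 0 := by
      intro h
      have h1 : Complex.exp (2 * π * ρ) = 1 := by linear_combination h
      have h2 : 1 < ‖Complex.exp (2 * π * ρ)‖ := by
        rw [Complex.norm_exp, Real.one_lt_exp_iff]
        simp
        positivity
      rw [h1] at h2
      simp at h2
    have hne := Complex.exp_ne_zero (2 * π * ρ)
    rw [Complex.exp_neg (2 * π * ρ)]
    have h3 : 1 - (Complex.exp (2 * π * ρ))⁻¹ =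
        (Complex.exp (2 * π * ρ) - 1) / Complex.exp (2 * π * ρ) := by
      field_simp
    rw [h3]
    field_simp
    ring
end
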